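/- arXiv:2402.16425 — 3 statements merged into one kernel-verified Lean document; each statement's English description precedes it below -/
import Mathlib

section
/- There is an absolute constant C such that for all positive integers n and r with r < n/2, the number N(n,r) of solutions of the equation p₁ + r·p₂ = n in prime numbers p₁, p₂ satisfies N(n,r) ≤ C · n^2 / (φ(n·r) · (log(n/r))^2). -/
open Finset Real

open scoped Classical

/-- The number of ordered pairs of primes `(p₁, p₂)` with `p₁ + r * p₂ = n`. -/
noncomputable def NN (n r : ℕ) : ℕ :=
  Set.ncard {p : ℕ × ℕ | p.1.Prime ∧ p.2.Prime ∧ p.1 + r * p.2 = n}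

theorem sum_le_sum_of_injOn_of_nonneg {ι κ : Type*} {s : Finset ι} {t : Finset κ} {f : ι → ℝ}
    {g : κ → ℝ} (i : ι → κ) (hi : ∀ a ∈ s, i a ∈ t) (hinj : Set.InjOn i s)
    (hfg : ∀ a ∈ s, f a ≤ g (i a)) (hg : ∀ b ∈ t, 0 ≤ g b) :
    ∑ a ∈ s, f a ≤ ∑ b ∈ t, g b :=
  calc ∑ a ∈ s, f a ≤ ∑ a ∈ s, g (i a) := sum_le_sum hfg
    _ = ∑ b ∈ s.image i, g b := (sum_image hinj).symm
    _ ≤ ∑ b ∈ t, g b :=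
      sum_le_sum_of_subset_of_nonneg (image_subset_iff.2 hi) fun b hb _ => hg b hb

theorem prod_one_sub_inv_mul_sum_inv_le (Q : Finset ℕ) (hQ : ∀ p ∈ Q, p.Prime) (y : ℕ) :
    (∏ p ∈ Q, (1 - (p : ℝ)⁻¹)) * ∑ b ∈ Icc 1 y, (b : ℝ)⁻¹ ≤
      ∑ b ∈ Icc 1 y with ∀ p ∈ Q, ¬ p ∣ b, (b : ℝ)⁻¹ := by
  induction Q using Finset.induction_on with
  | empty => simp
  | insert q Q hq ih =>
    have ih := ih fun p hp => hQ p (mem_insert_of_mem hp)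
    have hqp : q.Prime := hQ q (mem_insert_self q Q)
    have hq1 : (1 : ℝ) ≤ q := by exact_mod_cast hqp.one_lt.le
    have hsub : ∑ b ∈ Icc 1 y with (∀ p ∈ Q, ¬ p ∣ b) ∧ q ∣ b, (b : ℝ)⁻¹ ≤
        (q : ℝ)⁻¹ * ∑ b ∈ Icc 1 y with ∀ p ∈ Q, ¬ p ∣ b, (b : ℝ)⁻¹ := by
      rw [mul_sum]
      refine sum_le_sum_of_injOn_of_nonneg (fun b => b / q) ?_ ?_ ?_ fun b _ => by positivity
      · rintro b hb
        simp only [mem_filter, mem_Icc] at hb ⊢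
        obtain ⟨⟨h1, h2⟩, h3, c, rfl⟩ := hb
        rw [Nat.mul_div_cancel_left _ hqp.pos]
        refine ⟨⟨Nat.pos_of_mul_pos_left h1, ?_⟩, fun p hp hpc => h3 p hp (hpc.mul_left q)⟩
        exact (Nat.le_mul_of_pos_left c hqp.pos).trans h2
      · rintro a ha b hb hab
        simp only [mem_coe, mem_filter] at ha hb
        exact Nat.div_left_inj ha.2.2 hb.2.2 |>.1 hab
      · rintro b hb
        simp only [mem_filter, mem_Icc] at hb
        obtain ⟨⟨h1, h2⟩, h3, c, rfl⟩ := hb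
        rw [Nat.mul_div_cancel_left _ hqp.pos]
        push_cast
        rw [mul_inv]
    have hsplit : ∑ b ∈ Icc 1 y with ∀ p ∈ Q, ¬ p ∣ b, (b : ℝ)⁻¹ =
        ∑ b ∈ Icc 1 y with (∀ p ∈ Q, ¬ p ∣ b) ∧ q ∣ b, (b : ℝ)⁻¹ +
        ∑ b ∈ Icc 1 y with ∀ p ∈ insert q Q, ¬ p ∣ b, (b : ℝ)⁻¹ := by
      rw [← sum_filter_add_sum_filter_not _ (fun b => q ∣ b), filter_filter, filter_filter]
      congr 2
      ext b
      simp only [mem_filter, mem_insert, forall_eq_or_imp]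
      tauto
    rw [prod_insert hq, mul_assoc]
    have h0 : 0 ≤ 1 - (q : ℝ)⁻¹ := sub_nonneg.2 (inv_le_one_of_one_le₀ hq1)
    have := mul_le_mul_of_nonneg_left ih h0
    linarith

theorem totient_div_mul_sum_inv_le {K : ℕ} (hK : K ≠ 0) (y : ℕ) :
    (K.totient / K : ℝ) * ∑ b ∈ Icc 1 y, (b : ℝ)⁻¹ ≤
      ∑ b ∈ Icc 1 y with b.Coprime K, (b : ℝ)⁻¹ := by
  have hK' : (K : ℝ) ≠ 0 := by exact_mod_cast hK
  have hphi : (K.totient / K : ℝ) = ∏ p ∈ K.primeFactors, (1 - (p : ℝ)⁻¹) := by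
    have := congrArg (Rat.cast (K := ℝ)) (Nat.totient_eq_mul_prod_factors K)
    push_cast at this
    rw [this, mul_div_cancel_left₀ _ hK']
  rw [hphi]
  refine (prod_one_sub_inv_mul_sum_inv_le _ (fun p => Nat.prime_of_mem_primeFactors) y).trans_eq ?_
  congr 1
  refine filter_congr fun b _ => ?_
  rw [Nat.coprime_comm]
  refine ⟨fun h => Nat.coprime_of_dvd fun p hp hpK => h p (hp.mem_primeFactors hpK hK),
    fun h p hp hpb => ?_⟩
  exact Nat.not_coprime_of_dvd_of_dvd (Nat.prime_of_mem_primeFactors hp).one_lt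
    (Nat.dvd_of_mem_primeFactors hp) hpb h

/-- The indicator function of the positive integers coprime to `K`. -/
noncomputable def coprimeIndicator (K : ℕ) : ArithmeticFunction ℝ :=
  ⟨fun d => if d ≠ 0 ∧ d.Coprime K then 1 else 0, by simp⟩

theorem coprimeIndicator_apply (K d : ℕ) :
    coprimeIndicator K d = if d ≠ 0 ∧ d.Coprime K then 1 else 0 := rfl

/-- The number of divisors of `m` that are coprime to `K`, as an arithmetic function of `m`. -/
noncomputable def coprimeDivisors (K : ℕ) : ArithmeticFunction ℝ :=
  (ArithmeticFunction.zeta : ArithmeticFunction ℝ) * coprimeIndicator K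

theorem coprimeDivisors_apply (K m : ℕ) :
    coprimeDivisors K m = #{d ∈ m.divisors | d.Coprime K} := by
  rw [coprimeDivisors, ArithmeticFunction.coe_zeta_mul_apply, card_filter]
  push_cast
  refine sum_congr rfl fun d hd => ?_
  simp [coprimeIndicator_apply, (Nat.pos_of_mem_divisors hd).ne']

theorem isMultiplicative_coprimeDivisors (K : ℕ) : (coprimeDivisors K).IsMultiplicative := by
  refine ArithmeticFunction.isMultiplicative_zeta.natCast.mul
    ⟨by simp [coprimeIndicator_apply], fun {m n} _ => ?_⟩
  simp only [coprimeIndicator_apply, ne_eq, mul_eq_zero, not_or, Nat.coprime_mul_iff_left]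
  split_ifs <;> simp <;> tauto

theorem coprimeDivisors_prime_pow_le (K : ℕ) {p : ℕ} (hp : p.Prime) (k : ℕ) :
    coprimeDivisors K (p ^ k) ≤ (if p ∣ K then 1 else 2) ^ k := by
  rw [coprimeDivisors_apply]
  split_ifs with h
  · rw [one_pow, Nat.cast_le_one, card_le_one]
    have key : ∀ d ∈ (p ^ k).divisors, d.Coprime K → d = 1 := by
      intro d hd hc
      obtain ⟨j, -, rfl⟩ := (Nat.dvd_prime_pow hp).1 (Nat.dvd_of_mem_divisors hd)
      rcases Nat.eq_zero_or_pos j with rfl | hj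
      · simp
      · exact absurd h ((hp.coprime_iff_not_dvd).1 (Nat.Coprime.coprime_dvd_left
          (dvd_pow_self p hj.ne') hc))
    simp only [mem_filter]
    intro a ha b hb
    rw [key a ha.1 ha.2, key b hb.1 hb.2]
  · have h1 : #{d ∈ (p ^ k).divisors | d.Coprime K} ≤ k + 1 := by
      refine (card_filter_le _ _).trans ?_
      rw [Nat.divisors_prime_pow hp]
      simp
    have h2 : k + 1 ≤ 2 ^ k := Nat.lt_two_pow_self
    exact_mod_cast h1.trans h2

theorem sum_inv_mul_sum_coprime_inv_le (K y : ℕ) :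
    (∑ a ∈ Icc 1 y, (a : ℝ)⁻¹) * ∑ b ∈ Icc 1 y with b.Coprime K, (b : ℝ)⁻¹ ≤
      ∑ m ∈ Icc 1 (y ^ 2), coprimeDivisors K m / m := by
  rw [sum_mul_sum, ← sum_product',
    ← sum_fiberwise_of_maps_to (t := Icc 1 (y ^ 2)) (g := fun x : ℕ × ℕ => x.1 * x.2)]
  · refine sum_le_sum fun m hm => ?_
    rw [mem_Icc] at hm
    have : ∀ x ∈ {x ∈ Icc 1 y ×ˢ {b ∈ Icc 1 y | b.Coprime K} | x.1 * x.2 = m},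
        (x.1 : ℝ)⁻¹ * (x.2 : ℝ)⁻¹ = (m : ℝ)⁻¹ := by
      intro x hx
      rw [← (mem_filter.1 hx).2]
      push_cast
      rw [mul_inv]
    rw [sum_congr rfl this, sum_const, nsmul_eq_mul, div_eq_mul_inv, coprimeDivisors_apply]
    gcongr
    refine card_le_card_of_injOn Prod.snd ?_ ?_
    · intro x hx
      simp only [mem_coe, mem_product, mem_filter] at hx
      simp only [mem_coe, mem_filter, Nat.mem_divisors]
      exact ⟨⟨⟨x.1, by rw [← hx.2, mul_comm]⟩, by omega⟩, hx.1.2.2⟩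
    · rintro ⟨a, b⟩ hx ⟨c, d⟩ hx' (rfl : b = d)
      simp only [mem_coe, mem_product, mem_filter, mem_Icc] at hx hx'
      have : a = c := Nat.eq_of_mul_eq_mul_right (by omega) (hx.2.trans hx'.2.symm)
      rw [this]
  · rintro ⟨a, b⟩ hx
    simp only [mem_product, mem_filter, mem_Icc] at hx ⊢
    exact ⟨Nat.mul_pos hx.1.1 hx.2.1.1, by nlinarith⟩

theorem sum_le_prod_of_primeFactors_eq {f G : ℕ → ℝ} (hf0 : ∀ m, 0 ≤ f m)
    (hf : ∀ m, m ≠ 0 → f m = ∏ p ∈ m.primeFactors, f (p ^ m.factorization p))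
    (P T : Finset ℕ) (hG : ∀ p ∈ P, ∀ B, ∑ k ∈ Icc 1 B, f (p ^ k) ≤ G p)
    (hT : ∀ m ∈ T, m ≠ 0 ∧ m.primeFactors = P) :
    ∑ m ∈ T, f m ≤ ∏ p ∈ P, G p := by
  set B := T.sup id
  calc ∑ m ∈ T, f m ≤ ∑ e ∈ P.pi fun _ => Icc 1 B, ∏ x ∈ P.attach, f (x.1 ^ e x.1 x.2) := by
        refine sum_le_sum_of_injOn_of_nonneg (fun m p _ => m.factorization p) ?_ ?_ ?_ ?_
        · intro m hm
          simp only [mem_pi, mem_Icc]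
          obtain ⟨hm0, hmP⟩ := hT m hm
          intro p hp
          rw [← hmP] at hp
          refine ⟨(Nat.prime_of_mem_primeFactors hp).factorization_pos_of_dvd hm0
            (Nat.dvd_of_mem_primeFactors hp), ?_⟩
          exact (Nat.factorization_lt p hm0).le.trans (le_sup (f := id) hm)
        · intro a ha b hb hab
          obtain ⟨ha0, haP⟩ := hT a ha
          obtain ⟨hb0, hbP⟩ := hT b hb
          refine Nat.eq_of_factorization_eq ha0 hb0 fun p => ?_
          by_cases hp : p ∈ P
          · exact congrFun (congrFun hab p) hp
          · rw [Finsupp.notMem_support_iff.1 (by rwa [Nat.support_factorization, haP]),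
              Finsupp.notMem_support_iff.1 (by rwa [Nat.support_factorization, hbP])]
        · intro m hm
          obtain ⟨hm0, hmP⟩ := hT m hm
          rw [hf m hm0, hmP]
          exact (prod_attach P fun p => f (p ^ m.factorization p)).symm.le
        · exact fun e _ => prod_nonneg fun p _ => hf0 _
    _ = ∏ p ∈ P, ∑ k ∈ Icc 1 B, f (p ^ k) :=
        (prod_sum P (fun _ => Icc 1 B) fun p k => f (p ^ k)).symm
    _ ≤ ∏ p ∈ P, G p :=
        prod_le_prod (fun p _ => sum_nonneg fun k _ => hf0 _) fun p hp => hG p hp B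

theorem sum_Icc_le_sum_divisors_primorial {f G : ℕ → ℝ} (hf0 : ∀ m, 0 ≤ f m)
    (hf : ∀ m, m ≠ 0 → f m = ∏ p ∈ m.primeFactors, f (p ^ m.factorization p)) (z : ℕ)
    (hG : ∀ p, p.Prime → p ≤ z → ∀ B, ∑ k ∈ Icc 1 B, f (p ^ k) ≤ G p) :
    ∑ m ∈ Icc 1 z, f m ≤
      ∑ l ∈ (primorial z).divisors with l ≤ z, ∏ p ∈ l.primeFactors, G p := by
  have hrad : ∀ m ∈ Icc 1 z, ∏ p ∈ m.primeFactors, p ∈ {l ∈ (primorial z).divisors | l ≤ z} := by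
    intro m hm
    rw [mem_Icc] at hm
    have hle : ∏ p ∈ m.primeFactors, p ≤ z :=
      (Nat.le_of_dvd (by omega) (Nat.prod_primeFactors_dvd m)).trans hm.2
    rw [mem_filter, Nat.mem_divisors]
    refine ⟨⟨?_, (primorial_pos z).ne'⟩, hle⟩
    refine prod_dvd_prod_of_subset _ _ _ fun p hp => ?_
    rw [mem_filter, mem_range]
    exact ⟨by have := Nat.le_of_mem_primeFactors hp; omega, Nat.prime_of_mem_primeFactors hp⟩
  rw [← sum_fiberwise_of_maps_to hrad]
  refine sum_le_sum fun l hl => ?_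
  rw [mem_filter, Nat.mem_divisors] at hl
  refine sum_le_prod_of_primeFactors_eq hf0 hf _ _ ?_ ?_
  · intro p hp
    exact hG p (Nat.prime_of_mem_primeFactors hp) ((Nat.le_of_mem_primeFactors hp).trans hl.2)
  · intro m hm
    rw [mem_filter, mem_Icc] at hm
    refine ⟨by omega, ?_⟩
    rw [← hm.2, Nat.primeFactors_prod fun p => Nat.prime_of_mem_primeFactors]

namespace BoundingSieve
open ArithmeticFunction
open scoped ArithmeticFunction.Moebius

theorem sum_moebius_dvd_dvd {P l m : ℕ} (hP : Squarefree P) (hm : m ∣ P) :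
    ∑ d ∈ P.divisors, (if l ∣ d ∧ d ∣ m then (μ d : ℝ) else 0) =
      if l = m then (μ l : ℝ) else 0 := by
  have hm0 : m ≠ 0 := ne_zero_of_dvd_ne_zero hP.ne_zero hm
  by_cases hlm : l ∣ m
  · obtain ⟨k, rfl⟩ := hlm
    obtain ⟨hl0, hk0⟩ := mul_ne_zero_iff.1 hm0
    have hcop : l.Coprime k := Nat.coprime_of_squarefree_mul (hP.squarefree_of_dvd hm)
    have h1 : ∑ d ∈ P.divisors, (if l ∣ d ∧ d ∣ l * k then (μ d : ℝ) else 0) =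
        ∑ e ∈ k.divisors, (μ l : ℝ) * μ e := by
      rw [← sum_filter]
      symm
      refine sum_nbij (fun e => l * e) ?_ ?_ ?_ ?_
      · intro e he
        rw [Nat.mem_divisors] at he
        rw [mem_filter, Nat.mem_divisors]
        exact ⟨⟨(mul_dvd_mul_left l he.1).trans hm, hP.ne_zero⟩, dvd_mul_right l e,
          mul_dvd_mul_left l he.1⟩
      · intro a _ b _ hab
        exact Nat.eq_of_mul_eq_mul_left (Nat.pos_of_ne_zero hl0) hab
      · intro d hd
        rw [mem_coe, mem_filter] at hd
        obtain ⟨-, ⟨e, rfl⟩, hd2⟩ := hd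
        exact ⟨e, Nat.mem_divisors.2
          ⟨Nat.dvd_of_mul_dvd_mul_left (Nat.pos_of_ne_zero hl0) hd2, hk0⟩, rfl⟩
      · intro e he
        rw [isMultiplicative_moebius.map_mul_of_coprime
          (hcop.coprime_dvd_right (Nat.dvd_of_mem_divisors he))]
        push_cast
        rfl
    have h2 : ∑ e ∈ k.divisors, (μ e : ℝ) = if k = 1 then 1 else 0 := by
      have := congrArg (fun f => f k) moebius_mul_coe_zeta
      simp only [one_apply, coe_mul_zeta_apply] at this
      exact_mod_cast this
    rw [h1, ← mul_sum, h2]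
    by_cases hk : k = 1
    · simp [hk]
    · have : l ≠ l * k := fun h => hk (Nat.eq_of_mul_eq_mul_left (Nat.pos_of_ne_zero hl0)
        (by rw [← h, mul_one]))
      simp [hk, this]
  · rw [sum_eq_zero, if_neg]
    · rintro rfl
      exact hlm dvd_rfl
    · intro d _
      exact if_neg fun h => hlm (h.1.trans h.2)

/-- The sum of the Selberg terms up to `z`, the reciprocal of the minimal main term. -/
noncomputable def selbergSum (s : BoundingSieve) (z : ℕ) : ℝ :=
  ∑ l ∈ s.prodPrimes.divisors with l ≤ z, s.selbergTerms l

/-- The optimal weights of the Selberg sieve, supported on the divisors up to `z`. -/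
noncomputable def selbergWeight (s : BoundingSieve) (z d : ℕ) : ℝ :=
  μ d * (s.nu d)⁻¹ * (∑ l ∈ s.prodPrimes.divisors with l ≤ z,
    if d ∣ l then s.selbergTerms l else 0) / s.selbergSum z

variable {s : BoundingSieve} {z : ℕ}

theorem selbergSum_pos (hz : 1 ≤ z) : 0 < s.selbergSum z :=
  sum_pos (fun _ hl => selbergTerms_pos (Nat.dvd_of_mem_divisors (mem_filter.1 hl).1))
    ⟨1, mem_filter.2 ⟨Nat.one_mem_divisors.2 prodPrimes_ne_zero, hz⟩⟩

theorem selbergWeight_one (hz : 1 ≤ z) : s.selbergWeight z 1 = 1 := by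
  have := (selbergSum_pos (s := s) hz).ne'
  simp only [selbergWeight, moebius_apply_one, Int.cast_one, s.nu_mult.map_one, inv_one, one_mul,
    one_dvd, if_true]
  exact div_self this

theorem selbergWeight_eq_zero {d : ℕ} (hd : z < d) : s.selbergWeight z d = 0 := by
  rw [selbergWeight, sum_eq_zero, mul_zero, zero_div]
  intro l hl
  rw [mem_filter] at hl
  exact if_neg fun h => absurd (Nat.le_of_dvd (Nat.pos_of_mem_divisors hl.1) h) (by omega)

theorem abs_selbergWeight_le {d : ℕ} (hz : 1 ≤ z) (hd : d ∣ s.prodPrimes) :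
    |s.selbergWeight z d| ≤ (s.nu d)⁻¹ := by
  have hS := selbergSum_pos (s := s) hz
  have hν := nu_pos_of_dvd_prodPrimes hd
  have hg : ∀ l ∈ {l ∈ s.prodPrimes.divisors | l ≤ z}, 0 ≤ s.selbergTerms l := fun l hl =>
    (selbergTerms_pos (Nat.dvd_of_mem_divisors (mem_filter.1 hl).1)).le
  have h0 : 0 ≤ ∑ l ∈ s.prodPrimes.divisors with l ≤ z,
      if d ∣ l then s.selbergTerms l else 0 :=
    sum_nonneg fun l hl => by split_ifs; exacts [hg l hl, le_rfl]
  have h1 : ∑ l ∈ s.prodPrimes.divisors with l ≤ z,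
      (if d ∣ l then s.selbergTerms l else 0) ≤ s.selbergSum z :=
    sum_le_sum fun l hl => by split_ifs; exacts [le_rfl, hg l hl]
  have hμ : |(μ d : ℝ)| ≤ 1 := by exact_mod_cast abs_moebius_le_one
  rw [selbergWeight, abs_div, abs_mul, abs_mul, abs_of_pos hS, abs_of_nonneg h0,
    abs_of_pos (inv_pos.2 hν), div_le_iff₀ hS]
  calc _ ≤ 1 * (s.nu d)⁻¹ * s.selbergSum z := by gcongr
    _ = _ := by rw [one_mul]

theorem mainSum_selbergWeight (hz : 1 ≤ z) :
    s.mainSum (lambdaSquared (s.selbergWeight z)) = (s.selbergSum z)⁻¹ := by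
  have hS := (selbergSum_pos (s := s) hz).ne'
  have key : ∀ l ∈ s.prodPrimes.divisors,
      (∑ d ∈ s.prodPrimes.divisors, if l ∣ d then s.nu d * s.selbergWeight z d else 0) =
        if l ≤ z then μ l * s.selbergTerms l / s.selbergSum z else 0 := by
    intro l hl
    calc _ = ∑ d ∈ s.prodPrimes.divisors, ∑ m ∈ s.prodPrimes.divisors with m ≤ z,
          s.selbergTerms m / s.selbergSum z * if l ∣ d ∧ d ∣ m then (μ d : ℝ) else 0 := by
          refine sum_congr rfl fun d hd => ?_
          have hν := nu_ne_zero (Nat.dvd_of_mem_divisors hd)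
          by_cases h : l ∣ d
          · simp only [h, if_true, true_and, selbergWeight]
            rw [mul_div_assoc', ← mul_assoc, ← mul_assoc, mul_comm (s.nu d), mul_assoc _ (s.nu d),
              mul_inv_cancel₀ hν, mul_one, mul_sum, sum_div]
            refine sum_congr rfl fun m _ => ?_
            split_ifs <;> ring
          · simp [h]
      _ = ∑ m ∈ s.prodPrimes.divisors with m ≤ z,
          s.selbergTerms m / s.selbergSum z * if l = m then (μ l : ℝ) else 0 := by
          rw [sum_comm]
          refine sum_congr rfl fun m hm => ?_
          rw [← mul_sum, sum_moebius_dvd_dvd s.prodPrimes_squarefree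
            (Nat.dvd_of_mem_divisors (mem_filter.1 hm).1)]
      _ = _ := by
          simp only [mul_ite, mul_zero, sum_ite_eq, mem_filter, hl, true_and]
          split_ifs <;> ring
  rw [mainSum_lambdaSquared_eq_sum_mul_sum_sq]
  calc _ = ∑ l ∈ s.prodPrimes.divisors,
          if l ≤ z then s.selbergTerms l / s.selbergSum z ^ 2 else 0 := by
        refine sum_congr rfl fun l hl => ?_
        rw [key l hl]
        have hg := (selbergTerms_pos (Nat.dvd_of_mem_divisors hl)).ne'
        have hμ : (μ l : ℝ) ^ 2 = 1 := by
          exact_mod_cast moebius_sq_eq_one_of_squarefree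
            (squarefree_of_mem_divisors_prodPrimes hl)
        split_ifs
        · rw [div_pow, mul_pow, hμ]
          field_simp
        · simp
    _ = (∑ l ∈ s.prodPrimes.divisors with l ≤ z, s.selbergTerms l) / s.selbergSum z ^ 2 := by
        rw [← sum_filter, sum_div]
    _ = _ := by
        rw [← selbergSum, sq, div_mul_eq_div_div, div_self hS, one_div]

theorem errSum_lambdaSquared_le (w : ℕ → ℝ) (hrem : ∀ d, d ∣ s.prodPrimes → |s.rem d| ≤ d) :
    s.errSum (lambdaSquared w) ≤ (∑ d ∈ s.prodPrimes.divisors, |w d| * d) ^ 2 := by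
  calc s.errSum (lambdaSquared w)
      ≤ ∑ d ∈ s.prodPrimes.divisors, ∑ d₁ ∈ s.prodPrimes.divisors, ∑ d₂ ∈ s.prodPrimes.divisors,
          if d = d₁.lcm d₂ then |w d₁| * d₁ * (|w d₂| * d₂) else 0 := by
        refine sum_le_sum fun d hd => ?_
        have hd' := Nat.dvd_of_mem_divisors hd
        have hsub := Nat.divisors_subset_of_dvd prodPrimes_ne_zero hd'
        have hnn : ∀ d₁ d₂ : ℕ,
            (0 : ℝ) ≤ if d = d₁.lcm d₂ then |w d₁| * d₁ * (|w d₂| * d₂) else 0 := by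
          intro d₁ d₂
          split_ifs <;> positivity
        calc |lambdaSquared w d| * |s.rem d| ≤ |lambdaSquared w d| * d := by
              gcongr
              exact hrem d hd'
          _ ≤ (∑ d₁ ∈ d.divisors, ∑ d₂ ∈ d.divisors,
                if d = d₁.lcm d₂ then |w d₁| * |w d₂| else 0) * d := by
              gcongr
              refine (abs_sum_le_sum_abs _ _).trans (sum_le_sum fun d₁ _ => ?_)
              refine (abs_sum_le_sum_abs _ _).trans (sum_le_sum fun d₂ _ => ?_)
              split_ifs
              · rw [abs_mul]
              · rw [abs_zero]
          _ ≤ ∑ d₁ ∈ d.divisors, ∑ d₂ ∈ d.divisors,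
                if d = d₁.lcm d₂ then |w d₁| * d₁ * (|w d₂| * d₂) else 0 := by
              simp only [sum_mul]
              refine sum_le_sum fun d₁ hd₁ => sum_le_sum fun d₂ hd₂ => ?_
              split_ifs with h
              · have : (d : ℝ) ≤ d₁ * d₂ := by
                  rw [h]
                  exact_mod_cast Nat.le_of_dvd (Nat.mul_pos (Nat.pos_of_mem_divisors hd₁)
                    (Nat.pos_of_mem_divisors hd₂)) (Nat.lcm_dvd_mul d₁ d₂)
                calc |w d₁| * |w d₂| * d ≤ |w d₁| * |w d₂| * (d₁ * d₂) := by gcongr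
                  _ = _ := by ring
              · simp
          _ ≤ ∑ d₁ ∈ d.divisors, ∑ d₂ ∈ s.prodPrimes.divisors,
                if d = d₁.lcm d₂ then |w d₁| * d₁ * (|w d₂| * d₂) else 0 :=
              sum_le_sum fun d₁ _ => sum_le_sum_of_subset_of_nonneg hsub fun d₂ _ _ => hnn d₁ d₂
          _ ≤ _ := sum_le_sum_of_subset_of_nonneg hsub fun d₁ _ _ =>
              sum_nonneg fun d₂ _ => hnn d₁ d₂
    _ = (∑ d ∈ s.prodPrimes.divisors, |w d| * d) ^ 2 := by
        rw [sum_comm, sq, sum_mul_sum]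
        refine sum_congr rfl fun d₁ hd₁ => ?_
        rw [sum_comm]
        refine sum_congr rfl fun d₂ hd₂ => ?_
        rw [sum_ite_eq_of_mem']
        exact Nat.mem_divisors.2 ⟨Nat.lcm_dvd (Nat.dvd_of_mem_divisors hd₁)
          (Nat.dvd_of_mem_divisors hd₂), prodPrimes_ne_zero⟩

/-- A form of Selberg's sieve with a crude error term. -/
theorem siftedSum_le_div_selbergSum_add (hz : 1 ≤ z)
    (hrem : ∀ d, d ∣ s.prodPrimes → |s.rem d| ≤ d) (hnu : ∀ d, d ∣ s.prodPrimes → (s.nu d)⁻¹ ≤ d) :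
    s.siftedSum ≤ s.totalMass / s.selbergSum z + (z : ℝ) ^ 6 := by
  have h := siftedSum_le_mainSum_errSum_of_upperMoebius (s := s) _
    (upperMoebius_lambdaSquared (s.selbergWeight z) (selbergWeight_one hz))
  rw [mainSum_selbergWeight hz, ← div_eq_mul_inv] at h
  refine h.trans (add_le_add_right ((errSum_lambdaSquared_le _ hrem).trans ?_) _)
  have hsum : ∑ d ∈ s.prodPrimes.divisors, |s.selbergWeight z d| * d ≤ (z : ℝ) ^ 3 := by
    calc ∑ d ∈ s.prodPrimes.divisors, |s.selbergWeight z d| * d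
        = ∑ d ∈ s.prodPrimes.divisors with d ≤ z, |s.selbergWeight z d| * d := by
          rw [sum_filter]
          refine sum_congr rfl fun d _ => ?_
          split_ifs with hd
          · rfl
          · rw [selbergWeight_eq_zero (not_le.1 hd), abs_zero, zero_mul]
      _ ≤ ∑ d ∈ s.prodPrimes.divisors with d ≤ z, (z : ℝ) ^ 2 := by
          refine sum_le_sum fun d hd => ?_
          rw [mem_filter] at hd
          have hdP := Nat.dvd_of_mem_divisors hd.1
          have hdz : (d : ℝ) ≤ z := by exact_mod_cast hd.2
          have := ((abs_selbergWeight_le hz hdP).trans (hnu d hdP)).trans hdz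
          rw [sq]
          gcongr
      _ ≤ ∑ d ∈ Icc 1 z, (z : ℝ) ^ 2 := by
          refine sum_le_sum_of_subset_of_nonneg (fun d hd => ?_) fun _ _ _ => by positivity
          rw [mem_filter] at hd
          exact mem_Icc.2 ⟨Nat.pos_of_mem_divisors hd.1, hd.2⟩
      _ = (z : ℝ) ^ 3 := by simp; ring
  calc _ ≤ ((z : ℝ) ^ 3) ^ 2 := by gcongr
    _ = _ := by ring

end BoundingSieve

theorem abs_count_sub_le_of_periodic {p : ℕ → Prop} [DecidablePred p] {d : ℕ} (hd : 0 < d)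
    (hp : Function.Periodic p d) (M : ℕ) :
    |(Nat.count p M : ℝ) - Nat.count p d / d * M| ≤ d := by
  have hmul : ∀ q, Nat.count p (d * q) = q * Nat.count p d := by
    intro q
    induction q with
    | zero => simp
    | succ q ih =>
      rw [mul_add_one, Nat.count_add, ih, add_one_mul]
      congr 2
      funext k
      rw [add_comm, mul_comm, ← smul_eq_mul, hp.nsmul]
  have hsplit : Nat.count p M = (M / d) * Nat.count p d + Nat.count p (M % d) := by
    conv_lhs => rw [← Nat.div_add_mod M d, Nat.count_add, hmul]
    congr 2
    funext k
    rw [add_comm, mul_comm, ← smul_eq_mul, hp.nsmul]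
  have hd' : (0 : ℝ) < d := by exact_mod_cast hd
  have hM : (M : ℝ) = d * (M / d : ℕ) + (M % d : ℕ) := by exact_mod_cast (Nat.div_add_mod M d).symm
  have ht : ((M % d : ℕ) : ℝ) ≤ d := by exact_mod_cast (Nat.mod_lt M hd).le
  have hc : (Nat.count p (M % d) : ℝ) ≤ (M % d : ℕ) := by exact_mod_cast Nat.count_le p
  have hcd : (Nat.count p d : ℝ) / d ≤ 1 := by
    rw [div_le_one hd']
    exact_mod_cast Nat.count_le p
  have hcd0 : 0 ≤ (Nat.count p d : ℝ) / d := by positivity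
  have heq : (Nat.count p M : ℝ) - Nat.count p d / d * M =
      Nat.count p (M % d) - Nat.count p d / d * (M % d : ℕ) := by
    rw [hM, hsplit]
    push_cast
    field_simp
    ring
  have h1 : (Nat.count p d : ℝ) / d * (M % d : ℕ) ≤ (M % d : ℕ) :=
    mul_le_of_le_one_left (by positivity) hcd
  have h2 : 0 ≤ (Nat.count p d : ℝ) / d * (M % d : ℕ) := by positivity
  rw [heq, abs_le]
  constructor <;> linarith [(Nat.cast_nonneg (Nat.count p (M % d)) : (0 : ℝ) ≤ _)]

/-- The absolute value of `m * (n - r * m)`. -/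
def pairProd (n r m : ℕ) : ℕ := ((m : ℤ) * (n - r * m)).natAbs

/-- The number of roots of `x * (n - r * x)` modulo `d`. -/
noncomputable def rootCount (n r d : ℕ) : ℕ :=
  Nat.card {x : ZMod d // x * (n - r * x) = 0}

theorem dvd_pairProd_iff (n r d m : ℕ) :
    d ∣ pairProd n r m ↔ (m : ZMod d) * (n - r * m) = 0 := by
  rw [pairProd, ← Int.natCast_dvd, ← ZMod.intCast_zmod_eq_zero_iff_dvd]
  push_cast
  rfl

theorem rootCount_eq_count (n r : ℕ) {d : ℕ} (hd : 0 < d) :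
    rootCount n r d = Nat.count (fun m => d ∣ pairProd n r m) d := by
  have : NeZero d := ⟨hd.ne'⟩
  rw [rootCount, Nat.card_eq_fintype_card, Fintype.card_subtype, Nat.count_eq_card_filter_range]
  refine card_nbij' ZMod.val (fun m => (m : ZMod d)) ?_ ?_ ?_ ?_
  · intro x hx
    rw [mem_coe, mem_filter] at hx ⊢
    rw [mem_range, dvd_pairProd_iff, ZMod.natCast_zmod_val]
    exact ⟨ZMod.val_lt x, hx.2⟩
  · intro m hm
    rw [mem_coe, mem_filter, dvd_pairProd_iff] at hm
    exact mem_filter.2 ⟨mem_univ _, hm.2⟩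
  · intro x _
    exact ZMod.natCast_zmod_val x
  · intro m hm
    rw [mem_coe, mem_filter, mem_range] at hm
    exact ZMod.val_cast_of_lt hm.1

theorem rootCount_one (n r : ℕ) : rootCount n r 1 = 1 := by
  rw [rootCount_eq_count n r one_pos]
  simp

theorem rootCount_mul (n r : ℕ) {a b : ℕ} (hab : a.Coprime b) :
    rootCount n r (a * b) = rootCount n r a * rootCount n r b := by
  rw [rootCount, rootCount, rootCount, ← Nat.card_prod]
  refine Nat.card_congr (((ZMod.chineseRemainder hab).toEquiv.subtypeEquiv
    (q := fun x : ZMod a × ZMod b => x.1 * (n - r * x.1) = 0 ∧ x.2 * (n - r * x.2) = 0)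
    fun x => ?_).trans
    (Equiv.subtypeProdEquivProd (p := fun x : ZMod a => x * (n - r * x) = 0)
      (q := fun x : ZMod b => x * (n - r * x) = 0)))
  rw [← (ZMod.chineseRemainder hab).map_eq_zero_iff, Prod.ext_iff]
  simp

theorem rootCount_prime {n r p : ℕ} (hnr : n.Coprime r) (hp : p.Prime) :
    rootCount n r p = if p ∣ n * r then 1 else 2 := by
  have : Fact p.Prime := ⟨hp⟩
  have hn : (n : ZMod p) = 0 ↔ p ∣ n := ZMod.natCast_eq_zero_iff n p
  have hr : (r : ZMod p) = 0 ↔ p ∣ r := ZMod.natCast_eq_zero_iff r p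
  have hboth : ¬ (p ∣ n ∧ p ∣ r) := fun h => Nat.not_coprime_of_dvd_of_dvd hp.one_lt h.1 h.2 hnr
  rw [rootCount, Nat.card_eq_fintype_card, Fintype.card_subtype]
  split_ifs with h <;> rw [hp.dvd_mul] at h
  · rw [card_eq_one]
    refine ⟨0, ?_⟩
    ext x
    simp only [mem_filter, mem_univ, true_and, mem_singleton, mul_eq_zero]
    refine ⟨?_, Or.inl⟩
    rintro (hx | hx)
    · exact hx
    rcases h with h | h
    · rw [hn.2 h, zero_sub, neg_eq_zero, mul_eq_zero, hr] at hx
      exact hx.resolve_left fun h' => hboth ⟨h, h'⟩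
    · rw [hr.2 h, zero_mul, sub_zero, hn] at hx
      exact absurd ⟨hx, h⟩ hboth
  · rw [← hn, ← hr, not_or] at h
    rw [card_eq_two]
    refine ⟨0, n / r, (div_ne_zero h.1 h.2).symm, ?_⟩
    ext x
    simp only [mem_filter, mem_univ, true_and, mem_insert, mem_singleton, mul_eq_zero, sub_eq_zero]
    rw [eq_div_iff h.2, mul_comm x, eq_comm (a := (n : ZMod p))]

/-- The proportion of residues modulo `d` that are roots of `x * (n - r * x)`. -/
noncomputable def rootDensity (n r : ℕ) : ArithmeticFunction ℝ :=
  ⟨fun d => rootCount n r d / d, by simp⟩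

theorem rootDensity_apply (n r d : ℕ) : rootDensity n r d = rootCount n r d / d := rfl

theorem isMultiplicative_rootDensity (n r : ℕ) : (rootDensity n r).IsMultiplicative := by
  refine ⟨by simp [rootDensity_apply, rootCount_one], fun {a b} hab => ?_⟩
  rw [rootDensity_apply, rootDensity_apply, rootDensity_apply, rootCount_mul n r hab]
  push_cast
  rw [mul_div_mul_comm]

theorem rootDensity_prime {n r p : ℕ} (hnr : n.Coprime r) (hp : p.Prime) :
    rootDensity n r p = (if p ∣ n * r then 1 else 2) / p := by
  rw [rootDensity_apply, rootCount_prime hnr hp]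
  push_cast
  rfl

/-- The sieve of the values `m * (n - r * m)`, `m < M`, by the primes up to `z`. -/
noncomputable def pairSieve {n r : ℕ} (hnr : n.Coprime r) (heven : 2 ∣ n * r) (M z : ℕ) :
    BoundingSieve where
  support := (range M).image (pairProd n r)
  prodPrimes := primorial z
  prodPrimes_squarefree := squarefree_primorial z
  weights k := #{m ∈ range M | pairProd n r m = k}
  weights_nonneg _ := Nat.cast_nonneg _
  totalMass := M
  nu := rootDensity n r
  nu_mult := isMultiplicative_rootDensity n r
  nu_pos_of_prime p hp _ := by
    have : (0 : ℝ) < p := by exact_mod_cast hp.pos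
    rw [rootDensity_prime hnr hp]
    split_ifs <;> positivity
  nu_lt_one_of_prime p hp _ := by
    have h0 : (0 : ℝ) < p := by exact_mod_cast hp.pos
    rw [rootDensity_prime hnr hp, div_lt_one h0]
    split_ifs with h
    · exact_mod_cast hp.one_lt
    · have : p ≠ 2 := by
        rintro rfl
        exact h heven
      exact_mod_cast hp.two_le.lt_of_ne' this

section

variable {n r : ℕ} (hnr : n.Coprime r) (heven : 2 ∣ n * r) (M z : ℕ)

theorem sum_support_pairSieve (q : ℕ → Prop) [DecidablePred q] :
    (∑ k ∈ (pairSieve hnr heven M z).support,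
      if q k then (pairSieve hnr heven M z).weights k else 0) =
      #{m ∈ range M | q (pairProd n r m)} := by
  rw [← sum_filter, card_eq_sum_card_fiberwise (f := pairProd n r)
    (t := {k ∈ (range M).image (pairProd n r) | q k})]
  · push_cast
    refine sum_congr rfl fun k hk => ?_
    rw [mem_filter] at hk
    simp only [pairSieve, filter_filter]
    congr 2
    ext m
    simp only [mem_filter]
    refine ⟨fun h => ⟨h.1, by rw [h.2]; exact hk.2, h.2⟩, fun h => ⟨h.1, h.2.2⟩⟩
  · intro m hm
    rw [mem_coe, mem_filter] at hm ⊢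
    exact ⟨mem_image_of_mem _ hm.1, hm.2⟩

theorem siftedSum_pairSieve : (pairSieve hnr heven M z).siftedSum =
    #{m ∈ range M | (primorial z).Coprime (pairProd n r m)} := by
  rw [BoundingSieve.siftedSum]
  exact sum_support_pairSieve hnr heven M z (fun k => (primorial z).Coprime k)

theorem abs_rem_pairSieve_le {d : ℕ} (hd : 0 < d) : |(pairSieve hnr heven M z).rem d| ≤ d := by
  have hper : Function.Periodic (fun m => d ∣ pairProd n r m) d := by
    intro m
    simp only [dvd_pairProd_iff]
    push_cast
    rw [ZMod.natCast_self, add_zero]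
  have h : (pairSieve hnr heven M z).multSum d = Nat.count (fun m => d ∣ pairProd n r m) M := by
    rw [BoundingSieve.multSum, Nat.count_eq_card_filter_range]
    exact sum_support_pairSieve hnr heven M z (fun k => d ∣ k)
  rw [BoundingSieve.rem, h]
  change |_ - rootDensity n r d * (M : ℝ)| ≤ d
  rw [rootDensity_apply, rootCount_eq_count n r hd]
  exact abs_count_sub_le_of_periodic hd hper M

theorem selbergTerms_pairSieve {l : ℕ} (hl : l ∣ primorial z) :
    (pairSieve hnr heven M z).selbergTerms l =
      ∏ p ∈ l.primeFactors, rootDensity n r p / (1 - rootDensity n r p) := by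
  rw [BoundingSieve.selbergTerms_apply,
    ← BoundingSieve.prod_primeFactors_nu (s := pairSieve hnr heven M z) hl, ← prod_mul_distrib]
  rfl

theorem le_selbergSum_pairSieve (hK : n * r ≠ 0) (y : ℕ) :
    ((n * r).totient / (n * r : ℕ) : ℝ) * Real.log (y + 1) ^ 2 ≤
      (pairSieve hnr heven M (y ^ 2)).selbergSum (y ^ 2) := by
  have hlog : Real.log (y + 1) ≤ ∑ a ∈ Icc 1 y, (a : ℝ)⁻¹ := by
    have := log_add_one_le_harmonic y
    rw [harmonic_eq_sum_Icc] at this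
    push_cast at this
    exact this
  have hlog0 : 0 ≤ Real.log (y + 1) := Real.log_nonneg (by
    linarith [(Nat.cast_nonneg y : (0 : ℝ) ≤ y)])
  set H := ∑ a ∈ Icc 1 y, (a : ℝ)⁻¹
  have hf : ∀ m, m ≠ 0 → coprimeDivisors (n * r) m / m = ∏ p ∈ m.primeFactors,
      coprimeDivisors (n * r) (p ^ m.factorization p) / (p ^ m.factorization p : ℕ) := by
    intro m hm
    rw [prod_div_distrib, ← Nat.cast_prod]
    congr 1
    · exact (isMultiplicative_coprimeDivisors _).multiplicative_factorization _ hm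
    · exact congrArg _ (Nat.prod_factorization_pow_eq_self hm).symm
  have hG : ∀ p, p.Prime → p ≤ y ^ 2 → ∀ B, ∑ k ∈ Icc 1 B,
      coprimeDivisors (n * r) (p ^ k) / (p ^ k : ℕ) ≤
        rootDensity n r p / (1 - rootDensity n r p) := by
    intro p hp hpy B
    have hdvd : p ∣ (pairSieve hnr heven M (y ^ 2)).prodPrimes :=
      dvd_prod_of_mem _ (mem_filter.2 ⟨mem_range.2 (by omega), hp⟩)
    have h0 : 0 < rootDensity n r p := BoundingSieve.nu_pos_of_prime _ p hp hdvd
    have h1 : rootDensity n r p < 1 := BoundingSieve.nu_lt_one_of_prime _ p hp hdvd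
    calc _ ≤ ∑ k ∈ Ico 1 (B + 1), rootDensity n r p ^ k := by
          refine sum_le_sum fun k _ => ?_
          rw [rootDensity_prime hnr hp, div_pow]
          push_cast
          gcongr
          exact coprimeDivisors_prime_pow_le _ hp k
      _ ≤ rootDensity n r p ^ 1 / (1 - rootDensity n r p) := geom_sum_Ico_le_of_lt_one h0.le h1
      _ = _ := by rw [pow_one]
  calc _ ≤ ((n * r).totient / (n * r : ℕ) : ℝ) * H ^ 2 := by gcongr
    _ = H * (((n * r).totient / (n * r : ℕ) : ℝ) * H) := by ring
    _ ≤ H * ∑ b ∈ Icc 1 y with b.Coprime (n * r), (b : ℝ)⁻¹ := by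
        gcongr
        exact totient_div_mul_sum_inv_le hK y
    _ ≤ ∑ m ∈ Icc 1 (y ^ 2), coprimeDivisors (n * r) m / m :=
        sum_inv_mul_sum_coprime_inv_le (n * r) y
    _ ≤ ∑ l ∈ (primorial (y ^ 2)).divisors with l ≤ y ^ 2, ∏ p ∈ l.primeFactors,
          rootDensity n r p / (1 - rootDensity n r p) :=
        sum_Icc_le_sum_divisors_primorial (f := fun m => coprimeDivisors (n * r) m / m)
          (fun m => by rw [coprimeDivisors_apply]; positivity) hf _ hG
    _ = _ := by
        rw [BoundingSieve.selbergSum]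
        refine sum_congr rfl fun l hl => ?_
        rw [selbergTerms_pairSieve]
        exact Nat.dvd_of_mem_divisors (mem_filter.1 hl).1

end

theorem card_coprime_pairProd_le {n r : ℕ} (hnr : n.Coprime r) (heven : 2 ∣ n * r)
    (hK : n * r ≠ 0) (M : ℕ) {y : ℕ} (hy : 1 ≤ y) :
    (#{m ∈ range M | (primorial (y ^ 2)).Coprime (pairProd n r m)} : ℝ) ≤
      M * (n * r : ℕ) / ((n * r).totient * Real.log (y + 1) ^ 2) + (y : ℝ) ^ 12 := by
  have hz : 1 ≤ y ^ 2 := Nat.one_le_pow _ _ hy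
  have hφ : (0 : ℝ) < (n * r).totient := by
    exact_mod_cast Nat.totient_pos.2 (Nat.pos_of_ne_zero hK)
  have hK' : (0 : ℝ) < (n * r : ℕ) := by exact_mod_cast Nat.pos_of_ne_zero hK
  have hlog : 0 < Real.log (y + 1) := Real.log_pos (by
    have : (1 : ℝ) ≤ y := by exact_mod_cast hy
    linarith)
  rw [← siftedSum_pairSieve hnr heven]
  refine (BoundingSieve.siftedSum_le_div_selbergSum_add hz
    (fun d hd => abs_rem_pairSieve_le _ _ _ _ (Nat.pos_of_dvd_of_pos hd (primorial_pos _)))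
    fun d hd => ?_).trans ?_
  · have hν := BoundingSieve.nu_pos_of_dvd_prodPrimes hd
    change 0 < rootDensity n r d at hν
    change (rootDensity n r d)⁻¹ ≤ d
    rw [rootDensity_apply] at hν ⊢
    have : 0 < rootCount n r d := Nat.pos_of_ne_zero fun h => by simp [h] at hν
    rw [inv_div]
    exact div_le_self (Nat.cast_nonneg _) (by exact_mod_cast this)
  · refine add_le_add ?_ (by push_cast; rw [← pow_mul])
    change (M : ℝ) / _ ≤ _
    calc _ ≤ (M : ℝ) / (((n * r).totient / (n * r : ℕ) : ℝ) * Real.log (y + 1) ^ 2) :=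
          div_le_div_of_nonneg_left (Nat.cast_nonneg _) (by positivity)
            (le_selbergSum_pairSieve hnr heven M hK y)
      _ = _ := by field_simp

/-- The pairs counted by `NN`, as a finite set. -/
noncomputable def primePairs (n r : ℕ) : Finset (ℕ × ℕ) :=
  {p ∈ range (n + 1) ×ˢ range (n + 1) | p.1.Prime ∧ p.2.Prime ∧ p.1 + r * p.2 = n}

theorem mem_primePairs {n r : ℕ} (hr : 0 < r) {p : ℕ × ℕ} :
    p ∈ primePairs n r ↔ p.1.Prime ∧ p.2.Prime ∧ p.1 + r * p.2 = n := by
  rw [primePairs, mem_filter, mem_product, mem_range, mem_range]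
  refine ⟨And.right, fun h => ⟨⟨?_, ?_⟩, h⟩⟩
  · have := h.2.2
    omega
  · have := Nat.le_mul_of_pos_left p.2 hr
    omega

theorem NN_eq_card {n r : ℕ} (hr : 0 < r) : NN n r = #(primePairs n r) := by
  rw [NN, ← Set.ncard_coe_finset]
  congr 1
  ext p
  exact (mem_primePairs hr).symm

theorem injOn_fst_primePairs {n r : ℕ} (hr : 0 < r) :
    Set.InjOn Prod.fst (primePairs n r : Set (ℕ × ℕ)) := by
  rintro ⟨a, b⟩ hx ⟨c, d⟩ hy (rfl : a = c)
  have hx := ((mem_primePairs hr).1 hx).2.2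
  have hy := ((mem_primePairs hr).1 hy).2.2
  have : b = d := Nat.eq_of_mul_eq_mul_left hr (Nat.add_left_cancel (hx.trans hy.symm))
  rw [this]

theorem injOn_snd_primePairs {n r : ℕ} (hr : 0 < r) :
    Set.InjOn Prod.snd (primePairs n r : Set (ℕ × ℕ)) := by
  rintro ⟨a, b⟩ hx ⟨c, d⟩ hy (rfl : b = d)
  have hx := ((mem_primePairs hr).1 hx).2.2
  have hy := ((mem_primePairs hr).1 hy).2.2
  have : a = c := Nat.add_right_cancel (hx.trans hy.symm)
  rw [this]

theorem card_primePairs_le_two_of_not_coprime {n r : ℕ} (hr : 0 < r) (h : ¬ n.Coprime r) :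
    #(primePairs n r) ≤ 2 := by
  obtain ⟨q, hq, hqn, hqr⟩ := Nat.Prime.not_coprime_iff_dvd.1 h
  have := card_le_card_of_injOn (t := {q}) Prod.fst ?_ (injOn_fst_primePairs (n := n) hr)
  · exact this.trans (by simp)
  · intro p hp
    obtain ⟨hp₁, -, hp₃⟩ := (mem_primePairs hr).1 hp
    have hdvd : q ∣ p.1 := (Nat.dvd_add_left (hqr.mul_right p.2)).1 (hp₃ ▸ hqn)
    exact mem_coe.2 (mem_singleton.2 ((Nat.prime_dvd_prime_iff_eq hq hp₁).1 hdvd).symm)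

theorem card_primePairs_le_two_of_odd {n r : ℕ} (hr : 0 < r) (h : ¬ 2 ∣ n * r) :
    #(primePairs n r) ≤ 2 := by
  have hodd : ∀ p ∈ primePairs n r, p.1 ≠ 2 → p.2 = 2 := by
    intro p hp hp1
    obtain ⟨hp₁, hp₂, hp₃⟩ := (mem_primePairs hr).1 hp
    by_contra hp2
    have h1 := hp₁.odd_of_ne_two hp1
    have h2 := hp₂.odd_of_ne_two hp2
    rw [← even_iff_two_dvd, Nat.not_even_iff_odd, Nat.odd_mul] at h
    rw [← hp₃] at h
    exact Nat.not_even_iff_odd.2 h.1 (h1.add_odd (h.2.mul h2))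
  have h1 : #{p ∈ primePairs n r | p.1 = 2} ≤ #({2} : Finset ℕ) := by
    refine card_le_card_of_injOn Prod.fst (fun p hp => ?_)
      ((injOn_fst_primePairs hr).mono (coe_subset.2 (filter_subset _ _)))
    exact mem_coe.2 (mem_singleton.2 (mem_filter.1 hp).2)
  have h2 : #{p ∈ primePairs n r | ¬ p.1 = 2} ≤ #({2} : Finset ℕ) := by
    refine card_le_card_of_injOn Prod.snd (fun p hp => ?_)
      ((injOn_snd_primePairs hr).mono (coe_subset.2 (filter_subset _ _)))
    have hp := mem_filter.1 hp
    exact mem_coe.2 (mem_singleton.2 (hodd p hp.1 hp.2))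
  rw [← card_filter_add_card_filter_not (s := primePairs n r) (fun p => p.1 = 2)]
  exact add_le_add h1 h2

theorem card_primePairs_le_sifted {n r : ℕ} (hr : 0 < r) (z : ℕ) :
    #(primePairs n r) ≤
      2 * z + #{m ∈ range (n / r + 1) | (primorial z).Coprime (pairProd n r m)} := by
  have h1 : #{p ∈ primePairs n r | p.1 ≤ z} ≤ #(Icc 1 z) := by
    refine card_le_card_of_injOn Prod.fst (fun p hp => ?_)
      ((injOn_fst_primePairs hr).mono (coe_subset.2 (filter_subset _ _)))
    have hp := mem_filter.1 hp
    exact mem_coe.2 (mem_Icc.2 ⟨((mem_primePairs hr).1 hp.1).1.one_lt.le, hp.2⟩)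
  have h2 : #{p ∈ primePairs n r | ¬ p.1 ≤ z ∧ p.2 ≤ z} ≤ #(Icc 1 z) := by
    refine card_le_card_of_injOn Prod.snd (fun p hp => ?_)
      ((injOn_snd_primePairs hr).mono (coe_subset.2 (filter_subset _ _)))
    have hp := mem_filter.1 hp
    exact mem_coe.2 (mem_Icc.2 ⟨((mem_primePairs hr).1 hp.1).2.1.one_lt.le, hp.2.2⟩)
  have h3 : #{p ∈ primePairs n r | ¬ p.1 ≤ z ∧ ¬ p.2 ≤ z} ≤
      #{m ∈ range (n / r + 1) | (primorial z).Coprime (pairProd n r m)} := by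
    refine card_le_card_of_injOn Prod.snd (fun p hp => ?_)
      ((injOn_snd_primePairs hr).mono (coe_subset.2 (filter_subset _ _)))
    obtain ⟨hp, hz₁, hz₂⟩ := mem_filter.1 hp
    obtain ⟨hp₁, hp₂, hp₃⟩ := (mem_primePairs hr).1 hp
    have hle : p.2 ≤ n / r := (Nat.le_div_iff_mul_le hr).2 (by rw [mul_comm]; omega)
    have hF : pairProd n r p.2 = p.2 * p.1 := by
      have : (n : ℤ) - r * p.2 = p.1 := by
        rw [← hp₃]
        push_cast
        ring
      rw [pairProd, this, Int.natAbs_mul, Int.natAbs_natCast, Int.natAbs_natCast]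
    refine mem_coe.2 (mem_filter.2 ⟨mem_range.2 (by omega), ?_⟩)
    rw [hF, primorial]
    refine Nat.Coprime.prod_left fun q hq => ?_
    rw [mem_filter, mem_range] at hq
    exact ((Nat.coprime_primes hq.2 hp₂).2 (by omega)).mul_right
      ((Nat.coprime_primes hq.2 hp₁).2 (by omega))
  rw [Nat.card_Icc] at h1 h2
  rw [← card_filter_add_card_filter_not (s := primePairs n r) (fun p => p.1 ≤ z),
    ← card_filter_add_card_filter_not (s := {p ∈ primePairs n r | ¬ p.1 ≤ z}) (fun p => p.2 ≤ z),
    filter_filter, filter_filter]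
  omega

theorem sqrt_le_mul_div_log_sq {x : ℝ} (hx : 1 < x) :
    x ^ (1 / 2 : ℝ) ≤ 16 * (x / Real.log x ^ 2) := by
  have hx0 : 0 < x := by linarith
  have hlog : 0 < Real.log x := Real.log_pos hx
  have h := Real.log_le_rpow_div hx0.le (ε := 1 / 4) (by norm_num)
  have h1 : Real.log x ^ 2 ≤ 16 * x ^ (1 / 2 : ℝ) := by
    calc Real.log x ^ 2 ≤ (x ^ (1 / 4 : ℝ) / (1 / 4)) ^ 2 := by gcongr
      _ = 16 * (x ^ (1 / 4 : ℝ)) ^ (2 : ℕ) := by ring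
      _ = 16 * x ^ (1 / 2 : ℝ) := by
        rw [← Real.rpow_mul_natCast hx0.le]
        norm_num
  rw [← mul_div_assoc, le_div_iff₀ (by positivity)]
  calc x ^ (1 / 2 : ℝ) * Real.log x ^ 2 ≤ x ^ (1 / 2 : ℝ) * (16 * x ^ (1 / 2 : ℝ)) := by gcongr
    _ = 16 * (x ^ (1 / 2 : ℝ) * x ^ (1 / 2 : ℝ)) := by ring
    _ = 16 * x := by
      rw [← Real.rpow_add hx0]
      norm_num

theorem card_primePairs_le {n r : ℕ} (hr : 0 < r) (h2 : 2 < (n / r : ℝ)) :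
    (#(primePairs n r) : ℝ) ≤ 3 * (n / r : ℝ) ^ (1 / 2 : ℝ) +
      1152 * ((n : ℝ) ^ 2 / ((n * r).totient * Real.log (n / r) ^ 2)) := by
  have hr' : (0 : ℝ) < r := by exact_mod_cast hr
  have hn : n ≠ 0 := by
    rintro rfl
    norm_num at h2
  have hK : n * r ≠ 0 := mul_ne_zero hn hr.ne'
  have hφ : (0 : ℝ) < (n * r).totient := by
    exact_mod_cast Nat.totient_pos.2 (Nat.pos_of_ne_zero hK)
  have hxn : (n / r : ℝ) * r = n := div_mul_cancel₀ _ hr'.ne'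
  set x : ℝ := n / r with hx
  have hx0 : 0 < x := by linarith
  have hx1 : 1 < x := by linarith
  have hsqrt : 1 ≤ x ^ (1 / 2 : ℝ) := Real.one_le_rpow hx1.le (by norm_num)
  have htriv : 0 ≤ 1152 * ((n : ℝ) ^ 2 / ((n * r).totient * Real.log x ^ 2)) := by positivity
  by_cases hnr : n.Coprime r
  swap
  · have : (#(primePairs n r) : ℝ) ≤ 2 := by
      exact_mod_cast card_primePairs_le_two_of_not_coprime hr hnr
    linarith
  by_cases heven : 2 ∣ n * r
  swap
  · have : (#(primePairs n r) : ℝ) ≤ 2 := by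
      exact_mod_cast card_primePairs_le_two_of_odd hr heven
    linarith
  set y := ⌊x ^ (1 / 24 : ℝ)⌋₊
  have hy : 1 ≤ y := Nat.le_floor (by
    rw [Nat.cast_one]
    exact Real.one_le_rpow hx1.le (by norm_num))
  have hy1 : (1 : ℝ) ≤ y := by exact_mod_cast hy
  have hy12 : (y : ℝ) ^ 12 ≤ x ^ (1 / 2 : ℝ) := by
    calc (y : ℝ) ^ 12 ≤ (x ^ (1 / 24 : ℝ)) ^ 12 := by
          gcongr
          exact Nat.floor_le (by positivity)
      _ = _ := by
          rw [← Real.rpow_mul_natCast hx0.le]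
          norm_num
  have hy2 : (y : ℝ) ^ 2 ≤ y ^ 12 := pow_le_pow_right₀ hy1 (by norm_num)
  have hlogx : 0 < Real.log x := Real.log_pos hx1
  have hlog : Real.log x / 24 ≤ Real.log (y + 1) := by
    calc Real.log x / 24 = Real.log (x ^ (1 / 24 : ℝ)) := by
          rw [Real.log_rpow hx0]
          ring
      _ ≤ _ := Real.log_le_log (by positivity) (Nat.lt_floor_add_one _).le
  have hM : ((n / r + 1 : ℕ) : ℝ) ≤ 2 * x := by
    have : ((n / r : ℕ) : ℝ) ≤ x := Nat.cast_div_le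
    push_cast
    linarith
  have h1 : (#(primePairs n r) : ℝ) ≤ 2 * (y : ℝ) ^ 2 +
      #{m ∈ range (n / r + 1) | (primorial (y ^ 2)).Coprime (pairProd n r m)} := by
    exact_mod_cast card_primePairs_le_sifted hr (y ^ 2)
  have h3 := card_coprime_pairProd_le hnr heven hK (n / r + 1) hy
  have h4 : ((n / r + 1 : ℕ) : ℝ) * (n * r : ℕ) / ((n * r).totient * Real.log (y + 1) ^ 2) ≤
      1152 * ((n : ℝ) ^ 2 / ((n * r).totient * Real.log x ^ 2)) := by
    calc _ ≤ 2 * x * (n * r : ℕ) / ((n * r).totient * (Real.log x / 24) ^ 2) := by gcongr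
      _ = 1152 * ((x * r) * n / ((n * r).totient * Real.log x ^ 2)) := by
          push_cast
          field_simp
          norm_num
      _ = _ := by rw [hxn, sq (n : ℝ)]
  linarith

theorem count_p1_add_r_p2 :
    ∃ C : ℝ, ∀ n r : ℕ, 0 < n → 0 < r → (r : ℝ) < (n : ℝ) / 2 →
      (NN n r : ℝ) ≤ C * (n : ℝ) ^ 2 /
        ((Nat.totient (n * r) : ℝ) * Real.log ((n : ℝ) / (r : ℝ)) ^ 2) := by
  refine ⟨1200, fun n r hn hr hnr => ?_⟩
  have hr' : (0 : ℝ) < r := by exact_mod_cast hr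
  have hn' : (0 : ℝ) < n := by exact_mod_cast hn
  have h2 : 2 < (n / r : ℝ) := by
    rw [lt_div_iff₀ hr']
    linarith
  have hφ : (0 : ℝ) < (n * r).totient := by exact_mod_cast Nat.totient_pos.2 (Nat.mul_pos hn hr)
  have hφle : ((n * r).totient : ℝ) ≤ n * r := by exact_mod_cast Nat.totient_le (n * r)
  have hlog : 0 < Real.log (n / r : ℝ) := Real.log_pos (by linarith)
  have hsqrt := sqrt_le_mul_div_log_sq (x := (n / r : ℝ)) (by linarith)
  have hx : (n / r : ℝ) / Real.log (n / r) ^ 2 ≤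
      (n : ℝ) ^ 2 / ((n * r).totient * Real.log (n / r) ^ 2) := by
    calc (n / r : ℝ) / Real.log (n / r) ^ 2
        = (n : ℝ) ^ 2 / ((n * r) * Real.log (n / r) ^ 2) := by field_simp
      _ ≤ _ := by gcongr
  have h := card_primePairs_le hr h2
  rw [NN_eq_card hr, mul_div_assoc]
  linarith
end

section
/- Let a be a fixed nonzero integer and A > 0 a fixed real number, and set D = X^{1/2}/(log X)^{A+14}. There is a constant C = C(A, a) such that for all X > e^e and all positive integers q ≤ (log X)^A with gcd(q, a) = 1, the number of primes p ≤ X with p ≡ a (mod q) for which there exists an integer d with D < d < X/D, gcd(d, q) = 1 and d | p−1 is at most C · ((e/2)^{Ω(q)}/q) · X (log log X)^3 / (log X)^{2 − (e/2) log 2}. -/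
open Finset Real

open scoped Classical

/-- `Ω n`: the number of prime factors of `n` counted with multiplicity. -/
def bigOmega (n : ℕ) : ℕ := n.primeFactorsList.length

/-- The elementary symmetric sum of degree `k` of the values `x i`, `i ∈ S`. -/
noncomputable def elemSymm (S : Finset ℕ) (x : ℕ → ℝ) (k : ℕ) : ℝ :=
  ∑ T ∈ S.powersetCard k, ∏ i ∈ T, x i

lemma elemSymm_zero (S : Finset ℕ) (x : ℕ → ℝ) : elemSymm S x 0 = 1 := by
  simp [elemSymm]

lemma elemSymm_empty_succ (x : ℕ → ℝ) (k : ℕ) : elemSymm ∅ x (k + 1) = 0 := by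
  rw [elemSymm, powersetCard_eq_empty.2 (by simp), sum_empty]

lemma elemSymm_insert_succ {S : Finset ℕ} {i : ℕ} (hi : i ∉ S) (x : ℕ → ℝ) (k : ℕ) :
    elemSymm (insert i S) x (k + 1) = elemSymm S x (k + 1) + x i * elemSymm S x k := by
  unfold elemSymm
  rw [← Nat.succ_eq_add_one, powersetCard_succ_insert hi, sum_union, sum_image, mul_sum]
  · congr 1
    refine sum_congr rfl fun T hT => ?_
    rw [prod_insert]
    exact fun h => hi ((mem_powersetCard.1 hT).1 h)
  · intro T hT T' hT' h
    have h1 : i ∉ T := fun h => hi ((mem_powersetCard.1 hT).1 h)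
    have h2 : i ∉ T' := fun h => hi ((mem_powersetCard.1 hT').1 h)
    rw [← erase_insert h1, h, erase_insert h2]
  · rw [disjoint_left]
    intro T hT hT'
    obtain ⟨T', _, rfl⟩ := mem_image.1 hT'
    exact hi ((mem_powersetCard.1 hT).1 (mem_insert_self _ _))

lemma elemSymm_le_pow_div_factorial {S : Finset ℕ} {x : ℕ → ℝ} (hx : ∀ i ∈ S, 0 ≤ x i) (k : ℕ) :
    elemSymm S x k ≤ (∑ i ∈ S, x i) ^ k / k.factorial := by
  induction S using Finset.induction_on generalizing k with
  | empty =>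
    cases k with
    | zero => simp [elemSymm_zero]
    | succ k => simp [elemSymm_empty_succ]
  | insert i S hi ih =>
    have hx' : ∀ j ∈ S, 0 ≤ x j := fun j hj => hx j (mem_insert_of_mem hj)
    have hxi := hx i (mem_insert_self _ _)
    have hs : 0 ≤ ∑ j ∈ S, x j := sum_nonneg hx'
    cases k with
    | zero => simp [elemSymm_zero]
    | succ k =>
      rw [elemSymm_insert_succ hi, sum_insert hi]
      have h1 := ih hx' (k + 1)
      have h2 := mul_le_mul_of_nonneg_left (ih hx' k) hxi
      set s := ∑ j ∈ S, x j
      have hb : s ^ (k + 1) + (k + 1) * s ^ k * x i ≤ (x i + s) ^ (k + 1) := by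
        rw [add_comm (x i)]
        simpa using pow_add_mul_le_add_pow hs (by linarith : 0 ≤ 2 * s + x i) (k + 1)
      have hf : (0 : ℝ) < (k + 1).factorial := by positivity
      calc _ ≤ s ^ (k + 1) / (k + 1).factorial + x i * (s ^ k / k.factorial) := add_le_add h1 h2
        _ = (s ^ (k + 1) + (k + 1) * s ^ k * x i) / (k + 1).factorial := by
          rw [Nat.factorial_succ]; push_cast; field_simp
        _ ≤ _ := by gcongr

/-- The truncated inclusion-exclusion sum. -/
noncomputable def inclExcl (S : Finset ℕ) (x : ℕ → ℝ) (r : ℕ) : ℝ :=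
  ∑ j ∈ range (r + 1), (-1) ^ j * elemSymm S x j

lemma inclExcl_succ (S : Finset ℕ) (x : ℕ → ℝ) (r : ℕ) :
    inclExcl S x (r + 1) = inclExcl S x r + (-1) ^ (r + 1) * elemSymm S x (r + 1) := by
  simp [inclExcl, sum_range_succ]

lemma inclExcl_zero (S : Finset ℕ) (x : ℕ → ℝ) : inclExcl S x 0 = 1 := by
  simp [inclExcl, elemSymm_zero]

lemma inclExcl_insert_succ {S : Finset ℕ} {i : ℕ} (hi : i ∉ S) (x : ℕ → ℝ) (r : ℕ) :
    inclExcl (insert i S) x (r + 1) = inclExcl S x (r + 1) - x i * inclExcl S x r := by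
  induction r with
  | zero =>
    rw [inclExcl_succ, inclExcl_succ, elemSymm_insert_succ hi]
    simp [inclExcl_zero, elemSymm_zero]; ring
  | succ r ih =>
    rw [inclExcl_succ, ih, inclExcl_succ S x (r + 1), elemSymm_insert_succ hi,
      inclExcl_succ S x r]
    ring

/-- The Bonferroni inequalities for weights in `[0, 1]`. -/
lemma inclExcl_bonferroni {S : Finset ℕ} {x : ℕ → ℝ} (hx : ∀ i ∈ S, 0 ≤ x i ∧ x i ≤ 1) (r : ℕ) :
    0 ≤ (-1) ^ r * (inclExcl S x r - ∏ i ∈ S, (1 - x i)) := by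
  induction S using Finset.induction_on generalizing r with
  | empty =>
    have : inclExcl ∅ x r = 1 := by
      induction r with
      | zero => exact inclExcl_zero _ _
      | succ r ih => rw [inclExcl_succ, ih, elemSymm_empty_succ]; simp
    simp [this]
  | insert i S hi ih =>
    have hx' : ∀ j ∈ S, 0 ≤ x j ∧ x j ≤ 1 := fun j hj => hx j (mem_insert_of_mem hj)
    have hxi := hx i (mem_insert_self _ _)
    cases r with
    | zero =>
      rw [inclExcl_zero]
      have : ∏ j ∈ insert i S, (1 - x j) ≤ 1 :=
        prod_le_one (fun j hj => by linarith [(hx j hj).2]) (fun j hj => by linarith [(hx j hj).1])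
      simpa using this
    | succ r =>
      rw [inclExcl_insert_succ hi, prod_insert hi]
      have h1 := ih hx' (r + 1)
      have h2 := mul_nonneg hxi.1 (ih hx' r)
      rw [pow_succ] at h1 ⊢
      nlinarith

lemma prod_one_sub_le_inclExcl {S : Finset ℕ} {x : ℕ → ℝ} (hx : ∀ i ∈ S, 0 ≤ x i ∧ x i ≤ 1)
    {r : ℕ} (hr : Even r) : ∏ i ∈ S, (1 - x i) ≤ inclExcl S x r := by
  have := inclExcl_bonferroni hx r
  rw [hr.neg_one_pow] at this
  linarith

lemma inclExcl_le_prod_one_sub_add {S : Finset ℕ} {x : ℕ → ℝ} (hx : ∀ i ∈ S, 0 ≤ x i ∧ x i ≤ 1)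
    {r : ℕ} (hr : Even r) :
    inclExcl S x r ≤ ∏ i ∈ S, (1 - x i) + elemSymm S x (r + 1) := by
  have := inclExcl_bonferroni hx (r + 1)
  rw [inclExcl_succ, pow_succ, hr.neg_one_pow] at this
  linarith

lemma pow_div_factorial_le_exp_neg {t : ℝ} (ht : 0 ≤ t) {n : ℕ} (hn : exp 2 * t ≤ n) :
    t ^ n / n.factorial ≤ exp (-n) := by
  have h1 := Real.pow_div_factorial_le_exp (n : ℝ) (by positivity) n
  have h2 : t ≤ exp (-2) * n := by
    rw [Real.exp_neg, inv_mul_eq_div, le_div_iff₀ (exp_pos _)]; linarith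
  calc t ^ n / n.factorial ≤ (exp (-2) * n) ^ n / n.factorial := by gcongr
    _ = exp (-2) ^ n * ((n : ℝ) ^ n / n.factorial) := by rw [mul_pow]; ring
    _ ≤ exp (-2) ^ n * exp n := by gcongr
    _ = exp (-n) := by rw [← Real.exp_nat_mul, ← Real.exp_add]; congr 1; ring

lemma abs_card_modEq_sub_le (N : ℕ) {Q : ℕ} (hQ : 0 < Q) (c : ℕ) :
    |(#{m ∈ Icc 1 N | m ≡ c [MOD Q]} : ℝ) - N / Q| ≤ 1 := by
  have h := Nat.Ioc_filter_modEq_card 0 N hQ c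
  have hI : Ioc 0 N = Icc 1 N := by ext; simp [Nat.succ_le_iff]
  rw [hI] at h
  have hq : (0 : ℚ) < Q := by exact_mod_cast hQ
  have hle : ((0 : ℕ) - c : ℚ) / Q ≤ (N - c) / Q := by gcongr; simp
  rw [max_eq_left (sub_nonneg.2 (Int.floor_le_floor hle))] at h
  have h1 := Int.floor_le ((N - c : ℚ) / Q)
  have h2 := Int.lt_floor_add_one ((N - c : ℚ) / Q)
  have h3 := Int.floor_le (((0 : ℕ) - c : ℚ) / Q)
  have h4 := Int.lt_floor_add_one (((0 : ℕ) - c : ℚ) / Q)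
  have hd : (N - c : ℚ) / Q - ((0 : ℕ) - c : ℚ) / Q = N / Q := by push_cast; ring
  have h' : (#{m ∈ Icc 1 N | m ≡ c [MOD Q]} : ℚ) =
      ⌊(N - c : ℚ) / Q⌋ - ⌊((0 : ℕ) - c : ℚ) / Q⌋ := by exact_mod_cast h
  have key : |(#{m ∈ Icc 1 N | m ≡ c [MOD Q]} : ℚ) - N / Q| ≤ 1 := by
    rw [h', abs_le]; constructor <;> linarith
  have key' : ((|(#{m ∈ Icc 1 N | m ≡ c [MOD Q]} : ℚ) - N / Q| : ℚ) : ℝ) ≤ ((1 : ℚ) : ℝ) :=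
    Rat.cast_le.2 key
  push_cast at key'
  exact key'

/-- The periodic weight equal to `a` on multiples of `p`, to `b` on the class of `ρ` modulo `p`. -/
noncomputable def classWeight (a b : ℝ) (ρ : ℕ → ℕ) (p m : ℕ) : ℝ :=
  (if m ≡ 0 [MOD p] then a else 0) + if m ≡ ρ p [MOD p] then b else 0

lemma abs_sum_prod_classWeight_sub_le {a b : ℝ} (ha : 0 ≤ a) (hb : 0 ≤ b) (ρ : ℕ → ℕ) (N : ℕ)
    (T : Finset ℕ) (hT : ∀ p ∈ T, p.Prime) {Q : ℕ} (hQ : 0 < Q) (hQT : ∀ p ∈ T, Q.Coprime p)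
    (c : ℕ) :
    |∑ m ∈ Icc 1 N with m ≡ c [MOD Q], ∏ p ∈ T, classWeight a b ρ p m
      - N / Q * ∏ p ∈ T, ((a + b) / p)| ≤ (a + b) ^ #T := by
  induction T using Finset.induction_on generalizing Q c with
  | empty => simpa using abs_card_modEq_sub_le N hQ c
  | insert p T hp ih =>
    have hpp := hT p (mem_insert_self _ _)
    have hT' : ∀ p ∈ T, p.Prime := fun r hr => hT r (mem_insert_of_mem hr)
    have hQp := hQT p (mem_insert_self _ _)
    have hQp' : ∀ r ∈ T, (Q * p).Coprime r := fun r hr =>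
      Nat.Coprime.mul_left (hQT r (mem_insert_of_mem hr))
        ((Nat.coprime_primes hpp (hT' r hr)).2 (fun h => hp (h ▸ hr)))
    obtain ⟨c1, hc1, hc1'⟩ := Nat.chineseRemainder hQp c 0
    obtain ⟨c2, hc2, hc2'⟩ := Nat.chineseRemainder hQp c (ρ p)
    have hpos : 0 < Q * p := Nat.mul_pos hQ hpp.pos
    have i1 := ih hT' hpos hQp' c1
    have i2 := ih hT' hpos hQp' c2
    have e (d c' : ℕ) (h1 : c' ≡ c [MOD Q]) (h2 : c' ≡ d [MOD p]) (m : ℕ) :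
        (m ≡ c [MOD Q] ∧ m ≡ d [MOD p]) ↔ m ≡ c' [MOD Q * p] := by
      rw [← Nat.modEq_and_modEq_iff_modEq_mul hQp]
      exact ⟨fun h => ⟨h.1.trans h1.symm, h.2.trans h2.symm⟩,
        fun h => ⟨h.1.trans h1, h.2.trans h2⟩⟩
    have hsum : ∑ m ∈ Icc 1 N with m ≡ c [MOD Q], ∏ p ∈ insert p T, classWeight a b ρ p m
        = a * ∑ m ∈ Icc 1 N with m ≡ c1 [MOD Q * p], ∏ p ∈ T, classWeight a b ρ p m
        + b * ∑ m ∈ Icc 1 N with m ≡ c2 [MOD Q * p], ∏ p ∈ T, classWeight a b ρ p m := by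
      simp only [sum_filter, mul_sum, ← sum_add_distrib, prod_insert hp]
      refine sum_congr rfl fun m _ => ?_
      rw [← if_congr (e 0 c1 hc1 hc1' m) rfl rfl, ← if_congr (e (ρ p) c2 hc2 hc2' m) rfl rfl]
      unfold classWeight
      by_cases h1 : m ≡ c [MOD Q] <;> by_cases h2 : m ≡ 0 [MOD p] <;>
        by_cases h3 : m ≡ ρ p [MOD p] <;> (simp [h1, h2, h3]; try ring)
    have hp0 : (p : ℝ) ≠ 0 := by exact_mod_cast hpp.ne_zero
    have hQ0 : (Q : ℝ) ≠ 0 := by exact_mod_cast hQ.ne'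
    set S1 := ∑ m ∈ Icc 1 N with m ≡ c1 [MOD Q * p], ∏ p ∈ T, classWeight a b ρ p m
    set S2 := ∑ m ∈ Icc 1 N with m ≡ c2 [MOD Q * p], ∏ p ∈ T, classWeight a b ρ p m
    set M := N / ((Q * p : ℕ) : ℝ) * ∏ p ∈ T, ((a + b) / p)
    have hM : N / (Q : ℝ) * ∏ p ∈ insert p T, ((a + b) / p) = a * M + b * M := by
      simp only [M, prod_insert hp]; push_cast; field_simp
    rw [hsum, hM, card_insert_of_notMem hp]
    calc |a * S1 + b * S2 - (a * M + b * M)| = |a * (S1 - M) + b * (S2 - M)| := by ring_nf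
      _ ≤ |a * (S1 - M)| + |b * (S2 - M)| := abs_add_le _ _
      _ = a * |S1 - M| + b * |S2 - M| := by
        rw [abs_mul, abs_mul, abs_of_nonneg ha, abs_of_nonneg hb]
      _ ≤ a * (a + b) ^ #T + b * (a + b) ^ #T := by gcongr
      _ = _ := by ring

lemma classWeight_mem_Icc {a b : ℝ} (ha : 0 ≤ a) (ha1 : a ≤ 1) (hb : 0 ≤ b) (hb1 : b ≤ 1)
    {ρ : ℕ → ℕ} {p : ℕ} (hρ : ¬ p ∣ ρ p) (m : ℕ) :
    0 ≤ classWeight a b ρ p m ∧ classWeight a b ρ p m ≤ 1 := by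
  unfold classWeight
  by_cases h1 : m ≡ 0 [MOD p]
  · have h2 : ¬ m ≡ ρ p [MOD p] := fun h2 =>
      hρ ((Nat.modEq_zero_iff_dvd).1 (h2.symm.trans h1))
    simp [h1, h2, ha, ha1]
  · by_cases h2 : m ≡ ρ p [MOD p] <;> simp [h1, h2, hb, hb1]

lemma exp_two_le : exp 2 ≤ 8 := by
  have h : exp 2 = exp 1 * exp 1 := by rw [← Real.exp_add]; norm_num
  have := exp_one_lt_d9
  have := exp_pos 1
  rw [h]; nlinarith

/-- Brun's pure sieve, with weights on two residue classes for each prime. -/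
lemma sum_prod_one_sub_classWeight_le {a b : ℝ} (ha : 0 ≤ a) (ha1 : a ≤ 1) (hb : 0 ≤ b)
    (hb1 : b ≤ 1) {ρ : ℕ → ℕ} (N : ℕ) {P : Finset ℕ} (hP : ∀ p ∈ P, p.Prime)
    (hρ : ∀ p ∈ P, ¬ p ∣ ρ p) {Q : ℕ} (hQ : 0 < Q) (hQP : ∀ p ∈ P, Q.Coprime p) (c : ℕ)
    {W : ℝ} (hW : W - 1 ≤ ∑ p ∈ P, 1 / (p : ℝ)) (hW' : ∑ p ∈ P, 1 / (p : ℝ) ≤ W)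
    {r : ℕ} (hr : Even r) (hrW : exp 2 * (2 * W) ≤ r + 1) :
    ∑ m ∈ Icc 1 N with m ≡ c [MOD Q], ∏ p ∈ P, (1 - classWeight a b ρ p m)
      ≤ 9 * (N / Q) * exp (-((a + b) * W)) + (r + 1) * (2 * #P + 1) ^ r := by
  set κ := a + b with hκ
  have hκ0 : 0 ≤ κ := add_nonneg ha hb
  have hκ2 : κ ≤ 2 := by linarith
  have hW0 : 0 ≤ W := le_trans (sum_nonneg fun p _ => by positivity) hW'
  have hx : ∀ p ∈ P, 0 ≤ κ / (p : ℝ) ∧ κ / (p : ℝ) ≤ 1 := fun p hp => by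
    have : (2 : ℝ) ≤ p := by exact_mod_cast (hP p hp).two_le
    exact ⟨by positivity, by rw [div_le_one (by linarith)]; linarith⟩
  have hNQ : (0 : ℝ) ≤ N / Q := by positivity
  have hinner (j : ℕ) : (-1) ^ j * ∑ m ∈ Icc 1 N with m ≡ c [MOD Q],
      elemSymm P (fun p => classWeight a b ρ p m) j ≤
      N / Q * ((-1) ^ j * elemSymm P (fun p => κ / p) j) + (#P).choose j * κ ^ j := by
    have : |∑ m ∈ Icc 1 N with m ≡ c [MOD Q], elemSymm P (fun p => classWeight a b ρ p m) j
        - N / Q * elemSymm P (fun p => κ / p) j| ≤ (#P).choose j * κ ^ j := by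
      unfold elemSymm
      rw [sum_comm, mul_sum, ← sum_sub_distrib, ← card_powersetCard, ← nsmul_eq_mul]
      refine (abs_sum_le_sum_abs _ _).trans (sum_le_card_nsmul _ _ _ fun T hT => ?_)
      obtain ⟨hTP, hTc⟩ := mem_powersetCard.1 hT
      have := abs_sum_prod_classWeight_sub_le ha hb ρ N T (fun p hp => hP p (hTP hp)) hQ
        (fun p hp => hQP p (hTP hp)) c
      rwa [hTc] at this
    obtain ⟨h1, h2⟩ := abs_le.1 this
    rcases neg_one_pow_eq_or ℝ j with h | h <;> rw [h] <;> linarith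
  have hmain : ∑ m ∈ Icc 1 N with m ≡ c [MOD Q], ∏ p ∈ P, (1 - classWeight a b ρ p m)
      ≤ N / Q * inclExcl P (fun p => κ / p) r
        + ∑ j ∈ range (r + 1), (#P).choose j * κ ^ j := by
    calc _ ≤ ∑ m ∈ Icc 1 N with m ≡ c [MOD Q], inclExcl P (fun p => classWeight a b ρ p m) r :=
          sum_le_sum fun m _ => prod_one_sub_le_inclExcl
            (fun p hp => classWeight_mem_Icc ha ha1 hb hb1 (hρ p hp) m) hr
      _ = ∑ j ∈ range (r + 1), (-1) ^ j * ∑ m ∈ Icc 1 N with m ≡ c [MOD Q],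
          elemSymm P (fun p => classWeight a b ρ p m) j := by
        unfold inclExcl
        rw [sum_comm]
        simp_rw [mul_sum]
      _ ≤ ∑ j ∈ range (r + 1), (N / Q * ((-1) ^ j * elemSymm P (fun p => κ / p) j)
          + (#P).choose j * κ ^ j) := sum_le_sum fun j _ => hinner j
      _ = _ := by rw [sum_add_distrib, inclExcl, mul_sum]
  have herr : ∑ j ∈ range (r + 1), ((#P).choose j : ℝ) * κ ^ j ≤ (r + 1) * (2 * #P + 1) ^ r := by
    have : ∀ j ∈ range (r + 1), ((#P).choose j : ℝ) * κ ^ j ≤ (2 * #P + 1) ^ r := by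
      intro j hj
      have hjr : j ≤ r := Nat.lt_succ_iff.1 (mem_range.1 hj)
      have h1 : ((#P).choose j : ℝ) ≤ (#P : ℝ) ^ j := by exact_mod_cast Nat.choose_le_pow _ _
      calc ((#P).choose j : ℝ) * κ ^ j ≤ (#P : ℝ) ^ j * 2 ^ j := by gcongr
        _ = (2 * #P : ℝ) ^ j := by rw [mul_pow, mul_comm]
        _ ≤ (2 * #P + 1 : ℝ) ^ j := by gcongr; linarith
        _ ≤ _ := pow_le_pow_right₀ (by linarith [Nat.cast_nonneg (α := ℝ) #P]) hjr
    have := sum_le_card_nsmul _ _ _ this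
    simpa using this
  have hprod : ∏ p ∈ P, (1 - κ / (p : ℝ)) ≤ exp 2 * exp (-(κ * W)) := by
    calc ∏ p ∈ P, (1 - κ / (p : ℝ)) ≤ ∏ p ∈ P, exp (-(κ * (1 / p))) := by
          refine prod_le_prod (fun p hp => by linarith [(hx p hp).2]) fun p hp => ?_
          have := add_one_le_exp (-(κ * (1 / (p : ℝ))))
          refine le_trans (le_of_eq ?_) this
          ring
      _ = exp (-(κ * ∑ p ∈ P, 1 / (p : ℝ))) := by
          rw [← Real.exp_sum, sum_neg_distrib, mul_sum]
      _ ≤ exp (2 + -(κ * W)) := by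
          apply exp_le_exp.2
          nlinarith [mul_le_mul_of_nonneg_left hW hκ0]
      _ = _ := by rw [Real.exp_add]
  have htail : elemSymm P (fun p => κ / p) (r + 1) ≤ exp (-(κ * W)) := by
    have hs : ∑ p ∈ P, κ / (p : ℝ) = κ * ∑ p ∈ P, 1 / (p : ℝ) := by
      rw [mul_sum]; exact sum_congr rfl fun p _ => by ring
    have hs0 : 0 ≤ κ * ∑ p ∈ P, 1 / (p : ℝ) :=
      mul_nonneg hκ0 (sum_nonneg fun p _ => by positivity)
    have hs1 : κ * ∑ p ∈ P, 1 / (p : ℝ) ≤ 2 * W := by gcongr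
    have h1 := elemSymm_le_pow_div_factorial (fun p hp => (hx p hp).1) (r + 1)
    rw [hs] at h1
    have h2 := pow_div_factorial_le_exp_neg hs0 (n := r + 1) (by
      push_cast
      exact (mul_le_mul_of_nonneg_left hs1 (exp_pos 2).le).trans hrW)
    refine h1.trans (h2.trans (exp_le_exp.2 ?_))
    push_cast
    have h3 : (1 : ℝ) ≤ exp 2 := one_le_exp (by norm_num)
    have h4 : 2 * W ≤ exp 2 * (2 * W) := le_mul_of_one_le_left (by linarith) h3
    nlinarith [mul_le_mul_of_nonneg_right hκ2 hW0]
  have hincl := inclExcl_le_prod_one_sub_add hx hr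
  have hfin : inclExcl P (fun p => κ / (p : ℝ)) r ≤ 9 * exp (-(κ * W)) := by
    have := mul_le_mul_of_nonneg_right exp_two_le (exp_pos (-(κ * W))).le
    linarith
  have := mul_le_mul_of_nonneg_left hfin hNQ
  linarith

lemma natCast_eq_iff_modEq_val {q : ℕ} (hq : 0 < q) (x : ZMod q) (m : ℕ) :
    m ≡ x.val [MOD q] ↔ (m : ZMod q) = x := by
  have : NeZero q := ⟨hq.ne'⟩
  rw [← ZMod.natCast_eq_natCast_iff, ZMod.natCast_val, ZMod.cast_id', id]

lemma mul_add_one_eq_iff {q s : ℕ} (hs : s.Coprime q) (a : ZMod q) (m : ℕ) :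
    ((s * m + 1 : ℕ) : ZMod q) = a ↔ (m : ZMod q) = (a - 1) * (s : ZMod q)⁻¹ := by
  have h := ZMod.coe_mul_inv_eq_one s hs
  push_cast
  constructor
  · rintro rfl
    linear_combination -(m : ZMod q) * h
  · intro hm
    rw [hm]
    linear_combination (a - 1) * h

/-- Sieve bound for the integers `m ≤ N` with `s * m + 1` in a residue class and free of the
primes of `P`, weighted by `w` for each prime of `P` dividing `m`. -/
lemma sum_sieve_weight_le {w : ℝ} (hw0 : 0 ≤ w) (hw1 : w ≤ 1) (N : ℕ) {P : Finset ℕ}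
    (hP : ∀ p ∈ P, p.Prime) {q : ℕ} (hq : 0 < q) (hqP : ∀ p ∈ P, q.Coprime p) {s : ℕ}
    (hs : s.Coprime q) (a : ℤ) {W : ℝ} (hW : W - 1 ≤ ∑ p ∈ P with ¬ p ∣ s, 1 / (p : ℝ))
    (hW' : ∑ p ∈ P with ¬ p ∣ s, 1 / (p : ℝ) ≤ W) {r : ℕ} (hr : Even r)
    (hrW : exp 2 * (2 * W) ≤ r + 1) :
    ∑ m ∈ Icc 1 N with ((s * m + 1 : ℕ) : ZMod q) = (a : ZMod q),
      ∏ p ∈ P with ¬ p ∣ s, (if p ∣ s * m + 1 then 0 else if p ∣ m then w else 1)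
      ≤ 9 * (N / q) * exp (-((2 - w) * W)) + (r + 1) * (2 * #P + 1) ^ r := by
  set P' := {p ∈ P | ¬ p ∣ s} with hP'
  have hsub : P' ⊆ P := filter_subset _ _
  set ρ : ℕ → ℕ := fun p => (-(s : ZMod p)⁻¹).val with hρ
  have hcop : ∀ p ∈ P', s.Coprime p := fun p hp =>
    ((Nat.Prime.coprime_iff_not_dvd (hP p (hsub hp))).2 (mem_filter.1 hp).2).symm
  have hρiff : ∀ p ∈ P', ∀ m, m ≡ ρ p [MOD p] ↔ p ∣ s * m + 1 := by
    intro p hp m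
    rw [natCast_eq_iff_modEq_val (hP p (hsub hp)).pos, ← CharP.cast_eq_zero_iff (ZMod p) p,
      mul_add_one_eq_iff (hcop p hp)]
    simp
  have hρ' : ∀ p ∈ P', ¬ p ∣ ρ p := by
    intro p hp h
    have h0 := (hρiff p hp 0).1 ((Nat.modEq_zero_iff_dvd.2 h).symm)
    simp at h0
    exact (hP p (hsub hp)).one_lt.ne' h0
  have hm := sum_prod_one_sub_classWeight_le (a := 1 - w) (b := 1) (by linarith) (by linarith)
    zero_le_one le_rfl N (fun p hp => hP p (hsub hp)) hρ' hq (fun p hp => hqP p (hsub hp))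
    (((a : ZMod q) - 1) * (s : ZMod q)⁻¹).val hW hW' hr hrW
  have hcard : (#P' : ℝ) ≤ #P := by exact_mod_cast card_le_card hsub
  have hκ : 1 - w + 1 = 2 - w := by ring
  rw [hκ] at hm
  refine le_trans (le_of_eq ?_) (hm.trans (by gcongr))
  have hf : {m ∈ Icc 1 N | ((s * m + 1 : ℕ) : ZMod q) = (a : ZMod q)} =
      {m ∈ Icc 1 N | m ≡ (((a : ZMod q) - 1) * (s : ZMod q)⁻¹).val [MOD q]} := by
    refine filter_congr fun m _ => ?_
    rw [natCast_eq_iff_modEq_val hq, mul_add_one_eq_iff hs]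
  rw [hf]
  refine sum_congr rfl fun m _ => prod_congr rfl fun p hp => ?_
  unfold classWeight
  rw [if_congr (hρiff p hp m) rfl rfl, if_congr Nat.modEq_zero_iff_dvd rfl rfl]
  by_cases h1 : p ∣ s * m + 1
  · have h2 : ¬ p ∣ m := fun h2 => by
      have := (Nat.dvd_add_right (h2.mul_left s)).1 h1
      exact (hP p (hsub hp)).one_lt.ne' (Nat.dvd_one.1 this)
    simp [h1, h2]
  · by_cases h2 : p ∣ m <;> simp [h1, h2]

/-- The number of elements of `P` dividing `n`. -/
noncomputable def divCount (P : Finset ℕ) (n : ℕ) : ℕ := #{p ∈ P | p ∣ n}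

lemma prod_ite_dvd (P : Finset ℕ) (w : ℝ) (n : ℕ) :
    ∏ p ∈ P, (if p ∣ n then w else 1) = w ^ divCount P n := by
  rw [prod_ite, prod_const, prod_const_one, mul_one, divCount]

lemma sum_pow_divCount_le {w : ℝ} (hw0 : 0 ≤ w) (hw1 : w ≤ 1) (N : ℕ) {P : Finset ℕ}
    (hP : ∀ p ∈ P, p.Prime) {r : ℕ} (hr : Even r)
    (hrW : exp 2 * (2 * ∑ p ∈ P, 1 / (p : ℝ)) ≤ r + 1) :
    ∑ d ∈ Icc 1 N, w ^ divCount P d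
      ≤ 9 * N * exp (-((1 - w) * ∑ p ∈ P, 1 / (p : ℝ))) + (r + 1) * (2 * #P + 1) ^ r := by
  have hm := sum_prod_one_sub_classWeight_le (a := 1 - w) (b := 0) (ρ := fun _ => 1)
    (by linarith) (by linarith) le_rfl zero_le_one N hP
    (fun p hp h => (hP p hp).one_lt.ne' (Nat.dvd_one.1 h)) one_pos (fun p _ => by simp) 0
    (by linarith) le_rfl hr hrW
  simp only [Nat.modEq_one, filter_true, add_zero, Nat.cast_one, div_one] at hm
  refine le_trans (le_of_eq (sum_congr rfl fun d _ => ?_)) hm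
  rw [← prod_ite_dvd]
  refine prod_congr rfl fun p hp => ?_
  unfold classWeight
  rw [if_congr Nat.modEq_zero_iff_dvd rfl rfl]
  by_cases h : p ∣ d <;> simp [h]

/-- A dyadic decomposition bounds the logarithmic average of `w ^ divCount P d`. -/
lemma sum_pow_divCount_div_le {w : ℝ} (hw0 : 0 ≤ w) {P : Finset ℕ} {B E D : ℝ} (hD : 0 < D)
    (hB : 0 ≤ B) (hE : 0 ≤ E)
    (h : ∀ N : ℕ, ∑ d ∈ Icc 1 N, w ^ divCount P d ≤ B * N + E) (S : Finset ℕ) (J : ℕ)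
    (hS : ∀ d ∈ S, D < d ∧ (d : ℝ) < D * 2 ^ J) :
    ∑ d ∈ S, w ^ divCount P d / d ≤ J * (2 * B + E / D) := by
  induction J generalizing S with
  | zero =>
    have : S = ∅ := eq_empty_of_forall_notMem fun d hd => by
      have := hS d hd
      simp at this; linarith
    simp [this]
  | succ J ih =>
    rw [← sum_filter_add_sum_filter_not S (fun d : ℕ => (d : ℝ) < D * 2 ^ J)]
    have h1 := ih {d ∈ S | ((d : ℕ) : ℝ) < D * 2 ^ J} fun d hd =>
      ⟨(hS d (mem_filter.1 hd).1).1, (mem_filter.1 hd).2⟩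
    have hT : 0 < D * 2 ^ J := by positivity
    have h2 : ∑ d ∈ S with ¬ ((d : ℕ) : ℝ) < D * 2 ^ J, w ^ divCount P d / d ≤
        2 * B + E / D := by
      calc _ ≤ ∑ d ∈ S with ¬ ((d : ℕ) : ℝ) < D * 2 ^ J, w ^ divCount P d / (D * 2 ^ J) := by
            refine sum_le_sum fun d hd => ?_
            have := not_lt.1 (mem_filter.1 hd).2
            gcongr
        _ = (∑ d ∈ S with ¬ ((d : ℕ) : ℝ) < D * 2 ^ J, w ^ divCount P d) / (D * 2 ^ J) := by
            rw [sum_div]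
        _ ≤ (∑ d ∈ Icc 1 ⌊D * 2 ^ (J + 1)⌋₊, w ^ divCount P d) / (D * 2 ^ J) := by
            gcongr
            intro d hd
            have hd1 := hS d (mem_filter.1 hd).1
            refine mem_Icc.2 ⟨?_, Nat.le_floor hd1.2.le⟩
            have : (0 : ℝ) < d := hD.trans hd1.1
            exact_mod_cast this
        _ ≤ (B * (D * 2 ^ (J + 1)) + E) / (D * 2 ^ J) := by
            gcongr
            refine (h _).trans ?_
            gcongr
            exact Nat.floor_le (by positivity)
        _ = 2 * B + E / (D * 2 ^ J) := by field_simp; ring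
        _ ≤ _ := by
            gcongr
            exact le_mul_of_one_le_right hD.le (one_le_pow₀ (by norm_num))
    push_cast
    linarith

lemma sum_le_sum_of_subset_of_le {s t : Finset ℕ} {f g : ℕ → ℝ} (h : s ⊆ t)
    (hfg : ∀ i ∈ s, f i ≤ g i) (hg : ∀ i ∈ t, i ∉ s → 0 ≤ g i) :
    ∑ i ∈ s, f i ≤ ∑ i ∈ t, g i :=
  (sum_le_sum hfg).trans (sum_le_sum_of_subset_of_nonneg h hg)

lemma card_le_card_mul_add_one {N s : ℕ} (R : ℕ → Prop) :
    #{n ∈ Icc 2 N | s ∣ n - 1 ∧ R n} ≤ #{m ∈ Icc 1 (N / s) | R (s * m + 1)} := by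
  refine (card_le_card fun n hn => ?_).trans (card_image_le (f := fun m => s * m + 1))
  obtain ⟨hI, ⟨m, hm⟩, hR⟩ := mem_filter.1 hn
  obtain ⟨h1, h2⟩ := mem_Icc.1 hI
  have hn' : n = s * m + 1 := by omega
  have hpos : 0 < s * m := by omega
  refine mem_image.2 ⟨m, mem_filter.2 ⟨mem_Icc.2 ⟨Nat.pos_of_mul_pos_left hpos, ?_⟩, hn' ▸ hR⟩,
    hn'.symm⟩
  rw [Nat.le_div_iff_mul_le (Nat.pos_of_mul_pos_right hpos), mul_comm]
  omega

lemma card_filter_divCount_ge_le (N : ℕ) {q : ℕ} (hq : 0 < q) (a : ℤ) {P : Finset ℕ}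
    (hP : ∀ p ∈ P, p.Prime) (hqP : ∀ p ∈ P, q.Coprime p) (k : ℕ) :
    (#{n ∈ Icc 1 N | ((n : ℕ) : ZMod q) = a ∧ k ≤ divCount P (n - 1)} : ℝ)
      ≤ N / q * ((∑ p ∈ P, 1 / (p : ℝ)) ^ k / k.factorial) + (#P : ℝ) ^ k := by
  have hsub : {n ∈ Icc 1 N | ((n : ℕ) : ZMod q) = a ∧ k ≤ divCount P (n - 1)} ⊆
      (P.powersetCard k).biUnion fun S =>
        {n ∈ Icc 1 N | ((n : ℕ) : ZMod q) = a ∧ n ≡ 1 [MOD ∏ p ∈ S, p]} := by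
    intro n hn
    obtain ⟨hI, ha, hk⟩ := mem_filter.1 hn
    obtain ⟨S, hS, hSk⟩ := exists_subset_card_eq hk
    refine mem_biUnion.2 ⟨S, mem_powersetCard.2 ⟨hS.trans (filter_subset _ _), hSk⟩,
      mem_filter.2 ⟨hI, ha, ?_⟩⟩
    have hd : ∏ p ∈ S, p ∣ n - 1 := by
      refine Finset.prod_primes_dvd _ (fun p hp => (hP p (mem_filter.1 (hS hp)).1).prime)
        fun p hp => (mem_filter.1 (hS hp)).2
    exact ((Nat.modEq_iff_dvd' (mem_Icc.1 hI).1).2 hd).symm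
  have hone : ∀ S ∈ P.powersetCard k,
      (#{n ∈ Icc 1 N | ((n : ℕ) : ZMod q) = a ∧ n ≡ 1 [MOD ∏ p ∈ S, p]} : ℝ)
        ≤ N / q * ∏ p ∈ S, (1 / (p : ℝ)) + 1 := by
    intro S hS
    have hSP := (mem_powersetCard.1 hS).1
    have hcop : q.Coprime (∏ p ∈ S, p) :=
      Nat.Coprime.prod_right fun p hp => hqP p (hSP hp)
    have hpos : 0 < ∏ p ∈ S, p := prod_pos fun p hp => (hP p (hSP hp)).pos
    obtain ⟨c, hc1, hc2⟩ := Nat.chineseRemainder hcop (a : ZMod q).val 1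
    have hf : {n ∈ Icc 1 N | ((n : ℕ) : ZMod q) = a ∧ n ≡ 1 [MOD ∏ p ∈ S, p]} =
        {n ∈ Icc 1 N | n ≡ c [MOD q * ∏ p ∈ S, p]} := by
      refine filter_congr fun n _ => ?_
      rw [← natCast_eq_iff_modEq_val hq, ← Nat.modEq_and_modEq_iff_modEq_mul hcop]
      exact ⟨fun h => ⟨h.1.trans hc1.symm, h.2.trans hc2.symm⟩,
        fun h => ⟨h.1.trans hc1, h.2.trans hc2⟩⟩
    rw [hf]
    have := (abs_le.1 (abs_card_modEq_sub_le N (Nat.mul_pos hq hpos) c)).2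
    refine le_trans (by linarith) (le_of_eq (congrArg (· + 1) ?_) :
      (N : ℝ) / (q * ∏ p ∈ S, p : ℕ) + 1 ≤ _)
    push_cast
    rw [prod_div_distrib, prod_const_one]
    field_simp
  have h1 : (#{n ∈ Icc 1 N | ((n : ℕ) : ZMod q) = a ∧ k ≤ divCount P (n - 1)} : ℝ) ≤
      ∑ S ∈ P.powersetCard k, (N / q * ∏ p ∈ S, (1 / (p : ℝ)) + 1) := by
    refine le_trans ?_ (sum_le_sum hone)
    exact_mod_cast (card_le_card hsub).trans card_biUnion_le
  rw [sum_add_distrib, ← mul_sum, sum_const, card_powersetCard, nsmul_eq_mul, mul_one] at h1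
  refine h1.trans (add_le_add (mul_le_mul_of_nonneg_left ?_ (by positivity)) ?_)
  · exact elemSymm_le_pow_div_factorial (fun p _ => by positivity) k
  · exact_mod_cast Nat.choose_le_pow _ _

lemma sum_filter_not_dvd_bounds {P : Finset ℕ} {s : ℕ}
    (h : ∑ p ∈ P with p ∣ s, 1 / (p : ℝ) ≤ 1) :
    ∑ p ∈ P, 1 / (p : ℝ) - 1 ≤ ∑ p ∈ P with ¬ p ∣ s, 1 / (p : ℝ) ∧
      ∑ p ∈ P with ¬ p ∣ s, 1 / (p : ℝ) ≤ ∑ p ∈ P, 1 / (p : ℝ) := by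
  have h1 := sum_filter_add_sum_filter_not P (fun p => p ∣ s) (fun p => 1 / (p : ℝ))
  have h2 : 0 ≤ ∑ p ∈ P with p ∣ s, 1 / (p : ℝ) := sum_nonneg fun p _ => by positivity
  constructor <;> linarith

lemma card_filter_divCount_between_le {N q : ℕ} (hq : 0 < q) (a : ℤ) {P : Finset ℕ}
    (hP : ∀ p ∈ P, p.Prime) (hqP : ∀ p ∈ P, q.Coprime p)
    (hPs : ∀ s ∈ Icc 1 N, ∑ p ∈ P with p ∣ s, 1 / (p : ℝ) ≤ 1) {r : ℕ} (hr : Even r)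
    (hrW : exp 2 * (2 * ∑ p ∈ P, 1 / (p : ℝ)) ≤ r + 1) {β : ℝ} (hβ : 1 ≤ β) (v : ℝ) (k : ℕ) :
    (#{n ∈ Icc 2 N | ((n : ℕ) : ZMod q) = a ∧ (∀ p ∈ P, ¬ p ∣ n) ∧ v ≤ divCount P (n - 1) ∧
        divCount P (n - 1) < k} : ℝ)
      ≤ 9 * (N / q) * (β ^ (-v) * exp (-((2 - β) * ∑ p ∈ P, 1 / (p : ℝ))))
        + k * (#P + 1) ^ k * ((r + 1) * (2 * #P + 1) ^ r) := by
  set W := ∑ p ∈ P, 1 / (p : ℝ) with hW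
  set E : ℝ := (r + 1) * (2 * #P + 1) ^ r with hE
  have hE0 : 0 ≤ E := by positivity
  have hβ0 : 0 < β := by linarith
  set 𝒮 := {S ∈ P.powerset | v ≤ (#S : ℝ) ∧ #S < k} with h𝒮
  set R : Finset ℕ → ℕ → Prop := fun S n =>
    ((n : ℕ) : ZMod q) = a ∧ (∀ p ∈ P, ¬ p ∣ n) ∧ ∀ p ∈ P, p ∣ n - 1 → p ∈ S with hR
  have hsub : {n ∈ Icc 2 N | ((n : ℕ) : ZMod q) = a ∧ (∀ p ∈ P, ¬ p ∣ n) ∧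
      v ≤ divCount P (n - 1) ∧ divCount P (n - 1) < k} ⊆
      𝒮.biUnion fun S => {n ∈ Icc 2 N | ∏ p ∈ S, p ∣ n - 1 ∧ R S n} := by
    intro n hn
    obtain ⟨hI, ha, hn', hv, hk⟩ := mem_filter.1 hn
    refine mem_biUnion.2 ⟨{p ∈ P | p ∣ n - 1}, mem_filter.2
      ⟨mem_powerset.2 (filter_subset _ _), hv, hk⟩, mem_filter.2 ⟨hI, ?_, ha, hn', ?_⟩⟩
    · exact Finset.prod_primes_dvd _ (fun p hp => (hP p (mem_filter.1 hp).1).prime)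
        fun p hp => (mem_filter.1 hp).2
    · exact fun p hp hd => mem_filter.2 ⟨hp, hd⟩
  have hone : ∀ S ∈ 𝒮, (#{n ∈ Icc 2 N | ∏ p ∈ S, p ∣ n - 1 ∧ R S n} : ℝ) ≤
      9 * (N / q) * exp (-(2 * W)) * (β ^ (-v) * ∏ p ∈ S, (β / (p : ℝ))) + E := by
    intro S hS
    obtain ⟨hSP, hv, hk⟩ := mem_filter.1 hS
    have hSP := mem_powerset.1 hSP
    set s := ∏ p ∈ S, p with hs
    have hspos : 0 < s := prod_pos fun p hp => (hP p (hSP hp)).pos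
    have hdvd : ∀ p ∈ P, p ∣ s ↔ p ∈ S := by
      intro p hp
      refine ⟨fun h => ?_, fun h => dvd_prod_of_mem _ h⟩
      obtain ⟨p', hp', hd⟩ := (Prime.dvd_finsetProd_iff (hP p hp).prime _).1 h
      rwa [(Nat.prime_dvd_prime_iff_eq (hP p hp) (hP p' (hSP hp'))).1 hd]
    have hscop : s.Coprime q := Nat.Coprime.prod_left fun p hp => (hqP p (hSP hp)).symm
    have hmain : (#{m ∈ Icc 1 (N / s) | R S (s * m + 1)} : ℝ) ≤
        9 * ((N / s : ℕ) / q) * exp (-(2 * W)) + E := by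
      rcases lt_or_ge N s with hNs | hNs
      · rw [Nat.div_eq_of_lt hNs]
        simpa using hE0
      · obtain ⟨w1, w2⟩ := sum_filter_not_dvd_bounds (hPs s (mem_Icc.2 ⟨hspos, hNs⟩))
        have := sum_sieve_weight_le (w := 0) le_rfl zero_le_one (N / s) hP hq hqP hscop a w1 w2
          hr hrW
        rw [sub_zero] at this
        refine le_trans ?_ this
        rw [card_eq_sum_ones, Nat.cast_sum]
        refine sum_le_sum_of_subset_of_le ?_ ?_ ?_
        · intro m hm
          obtain ⟨hI, h1, -⟩ := mem_filter.1 hm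
          exact mem_filter.2 ⟨hI, h1⟩
        · intro m hm
          obtain ⟨hI, h1, h2, h3⟩ := mem_filter.1 hm
          rw [prod_eq_one]
          · simp
          · intro p hp
            obtain ⟨hpP, hps⟩ := mem_filter.1 hp
            have h4 : ¬ p ∣ m := fun h4 => hps ((hdvd p hpP).2 (h3 p hpP (by
              rw [Nat.add_sub_cancel]; exact h4.mul_left s)))
            rw [if_neg (h2 p hpP), if_neg h4]
        · intro m _ _
          exact prod_nonneg fun p _ => by split_ifs <;> norm_num
    have hβv : 1 ≤ β ^ (-v) * β ^ (#S : ℝ) := by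
      rw [← rpow_add hβ0]
      exact one_le_rpow hβ (by linarith)
    have hNs : ((N / s : ℕ) : ℝ) ≤ N / s := Nat.cast_div_le
    have hprod : ∏ p ∈ S, (β / (p : ℝ)) = β ^ (#S : ℝ) / s := by
      rw [prod_div_distrib, prod_const, rpow_natCast, hs]; push_cast; rfl
    calc (#{n ∈ Icc 2 N | s ∣ n - 1 ∧ R S n} : ℝ)
        ≤ #{m ∈ Icc 1 (N / s) | R S (s * m + 1)} := by
          refine Nat.cast_le.2 ?_
          convert card_le_card_mul_add_one (N := N) (s := s) (R S)
      _ ≤ 9 * ((N / s : ℕ) / q) * exp (-(2 * W)) + E := hmain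
      _ ≤ 9 * (N / s / q) * exp (-(2 * W)) * (β ^ (-v) * β ^ (#S : ℝ)) + E := by
          have h0 : 9 * ((N / s : ℕ) / q) * exp (-(2 * W)) ≤ 9 * (N / s / q) * exp (-(2 * W)) := by
            gcongr
          have h1 := le_mul_of_one_le_right
            (by positivity : 0 ≤ 9 * ((N : ℝ) / s / q) * exp (-(2 * W))) hβv
          linarith
      _ = _ := by rw [hprod]; field_simp
  have hcard : (#𝒮 : ℝ) ≤ k * (#P + 1) ^ k := by
    have h1 : 𝒮 ⊆ (range k).biUnion fun j => P.powersetCard j := by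
      intro S hS
      obtain ⟨hSP, hv, hk⟩ := mem_filter.1 hS
      exact mem_biUnion.2 ⟨#S, mem_range.2 hk, mem_powersetCard.2 ⟨mem_powerset.1 hSP, rfl⟩⟩
    have h2 : #𝒮 ≤ k * (#P + 1) ^ k := by
      refine (card_le_card h1).trans (card_biUnion_le.trans ?_)
      refine (sum_le_card_nsmul _ _ ((#P + 1) ^ k) fun j hj => ?_).trans (by simp)
      rw [card_powersetCard]
      exact (Nat.choose_le_pow _ _).trans ((Nat.pow_le_pow_left (Nat.le_succ _) j).trans
        (Nat.pow_le_pow_right (Nat.succ_pos _) (mem_range.1 hj).le))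
    exact_mod_cast h2
  have hsumprod : ∑ S ∈ 𝒮, ∏ p ∈ S, (β / (p : ℝ)) ≤ exp (β * W) := by
    calc _ ≤ ∑ S ∈ P.powerset, ∏ p ∈ S, (β / (p : ℝ)) :=
          sum_le_sum_of_subset_of_nonneg (filter_subset _ _)
            fun S _ _ => prod_nonneg fun p _ => by positivity
      _ = ∏ p ∈ P, (1 + β / (p : ℝ)) := (prod_one_add _).symm
      _ ≤ ∏ p ∈ P, exp (β * (1 / p)) := by
          refine prod_le_prod (fun p _ => by positivity) fun p _ => ?_
          have := add_one_le_exp (β * (1 / (p : ℝ)))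
          refine le_trans (le_of_eq ?_) this
          ring
      _ = _ := by rw [← Real.exp_sum, hW, mul_sum]
  calc _ ≤ ∑ S ∈ 𝒮, (#{n ∈ Icc 2 N | ∏ p ∈ S, p ∣ n - 1 ∧ R S n} : ℝ) := by
        exact_mod_cast (card_le_card hsub).trans card_biUnion_le
    _ ≤ ∑ S ∈ 𝒮, (9 * (N / q) * exp (-(2 * W)) * (β ^ (-v) * ∏ p ∈ S, (β / (p : ℝ))) + E) :=
        sum_le_sum hone
    _ = 9 * (N / q) * exp (-(2 * W)) * β ^ (-v) * ∑ S ∈ 𝒮, ∏ p ∈ S, (β / (p : ℝ)) + #𝒮 * E := by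
        rw [sum_add_distrib, sum_const, nsmul_eq_mul]
        congr 1
        rw [← mul_sum, ← mul_sum]
        ring
    _ ≤ 9 * (N / q) * exp (-(2 * W)) * β ^ (-v) * exp (β * W) + k * (#P + 1) ^ k * E := by
        gcongr
    _ = _ := by
        have : exp (-((2 - β) * W)) = exp (-(2 * W)) * exp (β * W) := by
          rw [← Real.exp_add]; ring_nf
        rw [this]; ring

lemma card_filter_divCount_le_le {N q : ℕ} (hq : 0 < q) (a : ℤ) {P : Finset ℕ}
    (hP : ∀ p ∈ P, p.Prime) (hqP : ∀ p ∈ P, q.Coprime p)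
    (hPs : ∀ s ∈ Icc 1 N, ∑ p ∈ P with p ∣ s, 1 / (p : ℝ) ≤ 1) {r : ℕ} (hr : Even r)
    (hrW : exp 2 * (2 * ∑ p ∈ P, 1 / (p : ℝ)) ≤ r + 1) {w : ℝ} (hw0 : 0 < w) (hw1 : w ≤ 1)
    (v : ℝ) {S : Finset ℕ} (hS : ∀ d ∈ S, d ∈ Icc 1 N ∧ d.Coprime q) :
    (#{n ∈ Icc 2 N | ((n : ℕ) : ZMod q) = a ∧ (∀ p ∈ P, ¬ p ∣ n) ∧ divCount P (n - 1) ≤ v ∧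
        ∃ d ∈ S, d ∣ n - 1} : ℝ)
      ≤ w ^ (-v) * (9 * (N / q) * exp (-((2 - w) * ∑ p ∈ P, 1 / (p : ℝ))) *
        ∑ d ∈ S, w ^ divCount P d / d + #S * ((r + 1) * (2 * #P + 1) ^ r)) := by
  set W := ∑ p ∈ P, 1 / (p : ℝ) with hW
  set E : ℝ := (r + 1) * (2 * #P + 1) ^ r with hE
  have hE0 : 0 ≤ E := by positivity
  set R : ℕ → Prop := fun n => ((n : ℕ) : ZMod q) = a ∧ (∀ p ∈ P, ¬ p ∣ n) ∧
    divCount P (n - 1) ≤ v with hR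
  have hsub : {n ∈ Icc 2 N | ((n : ℕ) : ZMod q) = a ∧ (∀ p ∈ P, ¬ p ∣ n) ∧ divCount P (n - 1) ≤ v ∧
      ∃ d ∈ S, d ∣ n - 1} ⊆ S.biUnion fun d => {n ∈ Icc 2 N | d ∣ n - 1 ∧ R n} := by
    intro n hn
    obtain ⟨hI, ha, hn', hv, d, hd, hdn⟩ := mem_filter.1 hn
    exact mem_biUnion.2 ⟨d, hd, mem_filter.2 ⟨hI, hdn, ha, hn', hv⟩⟩
  have hwv : 0 < w ^ (-v) := rpow_pos_of_pos hw0 _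
  have hone : ∀ d ∈ S, (#{n ∈ Icc 2 N | d ∣ n - 1 ∧ R n} : ℝ) ≤
      w ^ (-v) * (9 * (N / q) * exp (-((2 - w) * W)) * (w ^ divCount P d / d) + E) := by
    intro d hd
    obtain ⟨hdN, hdq⟩ := hS d hd
    have hd1 := (mem_Icc.1 hdN).1
    obtain ⟨w1, w2⟩ := sum_filter_not_dvd_bounds (hPs d hdN)
    have hsieve := sum_sieve_weight_le hw0.le hw1 (N / d) hP hq hqP hdq a w1 w2 hr hrW
    have hpow : w ^ divCount P d ≤ 1 := pow_le_one₀ hw0.le hw1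
    have hcount : (#{m ∈ Icc 1 (N / d) | R (d * m + 1)} : ℝ) ≤
        w ^ (-v) * (w ^ divCount P d * ∑ m ∈ Icc 1 (N / d) with
          ((d * m + 1 : ℕ) : ZMod q) = (a : ZMod q),
          ∏ p ∈ P with ¬ p ∣ d, (if p ∣ d * m + 1 then 0 else if p ∣ m then w else 1)) := by
      rw [mul_sum, mul_sum, card_eq_sum_ones, Nat.cast_sum]
      refine sum_le_sum_of_subset_of_le ?_ ?_ ?_
      · intro m hm
        obtain ⟨hI, h1, -⟩ := mem_filter.1 hm
        exact mem_filter.2 ⟨hI, h1⟩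
      · intro m hm
        obtain ⟨hI, h1, h2, h3⟩ := mem_filter.1 hm
        have h4 : ∏ p ∈ P with ¬ p ∣ d, (if p ∣ d * m + 1 then 0 else if p ∣ m then w else 1) =
            ∏ p ∈ P with ¬ p ∣ d, (if p ∣ d * m then w else 1) := by
          refine prod_congr rfl fun p hp => ?_
          obtain ⟨hpP, hpd⟩ := mem_filter.1 hp
          rw [if_neg (h2 p hpP)]
          simp [(hP p hpP).dvd_mul, hpd]
        have h5 : w ^ divCount P d = ∏ p ∈ P with p ∣ d, (if p ∣ d * m then w else 1) := by
          rw [divCount, ← prod_const]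
          refine prod_congr rfl fun p hp => ?_
          rw [if_pos ((mem_filter.1 hp).2.mul_right m)]
        rw [h4, h5, prod_filter_mul_prod_filter_not, prod_ite_dvd, ← rpow_natCast,
          ← rpow_add hw0]
        rw [Nat.add_sub_cancel] at h3
        simpa using one_le_rpow_of_pos_of_le_one_of_nonpos hw0 hw1 (by linarith)
      · intro m _ _
        refine mul_nonneg hwv.le (mul_nonneg (by positivity) (prod_nonneg fun p _ => ?_))
        split_ifs <;> linarith
    have hNs : ((N / d : ℕ) : ℝ) ≤ N / d := Nat.cast_div_le
    calc (#{n ∈ Icc 2 N | d ∣ n - 1 ∧ R n} : ℝ)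
        ≤ #{m ∈ Icc 1 (N / d) | R (d * m + 1)} := by
          refine Nat.cast_le.2 ?_
          convert card_le_card_mul_add_one (N := N) (s := d) R
      _ ≤ _ := hcount
      _ ≤ w ^ (-v) * (w ^ divCount P d *
          (9 * ((N / d : ℕ) / q) * exp (-((2 - w) * W)) + E)) := by gcongr
      _ ≤ w ^ (-v) * (w ^ divCount P d * (9 * (N / d / q) * exp (-((2 - w) * W))) + E) := by
          gcongr
          rw [mul_add]
          refine add_le_add (by gcongr) (mul_le_of_le_one_left hE0 hpow)
      _ = _ := by ring
  calc _ ≤ ∑ d ∈ S, (#{n ∈ Icc 2 N | d ∣ n - 1 ∧ R n} : ℝ) := by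
        exact_mod_cast (card_le_card hsub).trans card_biUnion_le
    _ ≤ _ := sum_le_sum hone
    _ = _ := by rw [← mul_sum, sum_add_distrib, sum_const, nsmul_eq_mul, ← mul_sum]

lemma sum_primes_one_div_sub_le {n : ℕ} (hn : 1 ≤ n) :
    ∑ p ∈ Icc 1 n with p.Prime, (1 / ((p : ℝ) - 1) - 1 / p) ≤ 1 - 1 / n := by
  induction n, hn using Nat.le_induction with
  | base => simp [sum_filter, Nat.not_prime_one]
  | succ n hn ih =>
    rw [sum_filter] at ih ⊢
    rw [sum_Icc_succ_top (by omega)]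
    have hn' : (0 : ℝ) < n := by exact_mod_cast hn
    have h1 : (0 : ℝ) ≤ 1 / n - 1 / (n + 1) := by
      rw [sub_nonneg]
      gcongr
      linarith
    push_cast
    rw [add_sub_cancel_right]
    split_ifs <;> linarith

lemma log_log_le_sum_primes_one_div {x : ℝ} (hx : 1 < x) :
    log (log x) ≤ ∑ p ∈ Icc 1 ⌊x⌋₊ with p.Prime, 1 / (p : ℝ) + 1 := by
  set n := ⌊x⌋₊ with hn
  have hn1 : 1 ≤ n := Nat.le_floor (by simpa using hx.le)
  let f : ℕ →* ℝ := ⟨⟨fun k => (k : ℝ)⁻¹, by simp⟩, fun a b => by simp [mul_comm]⟩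
  have hf : ∀ k, f k = (k : ℝ)⁻¹ := fun _ => rfl
  obtain ⟨hsum, hhas⟩ :=
    EulerProduct.summable_and_hasSum_smoothNumbers_prod_primesBelow_geometric (f := f)
      (fun {p} hp => by
        rw [hf, norm_inv, Real.norm_natCast]
        exact inv_lt_one_of_one_lt₀ (by exact_mod_cast hp.one_lt)) (n + 1)
  have hset : (n + 1).primesBelow = {p ∈ Icc 1 n | p.Prime} := by
    ext p
    simp only [Nat.mem_primesBelow, mem_filter, mem_Icc]
    exact ⟨fun h => ⟨⟨h.2.one_le, by omega⟩, h.2⟩, fun h => ⟨by omega, h.2⟩⟩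
  have hharm : log x ≤ ∏ p ∈ Icc 1 n with p.Prime, (1 - (p : ℝ)⁻¹)⁻¹ := by
    refine (log_le_harmonic_floor x (by linarith)).trans ?_
    rw [← hn, harmonic_eq_sum_Icc, ← hset]
    push_cast
    have hmem : ∀ m ∈ Icc 1 n, m ∈ (n + 1).smoothNumbers := fun m hm =>
      Nat.mem_smoothNumbers_of_lt (mem_Icc.1 hm).1 (Nat.lt_succ_of_le (mem_Icc.1 hm).2)
    have h1 := sum_le_hasSum ((Icc 1 n).subtype (· ∈ (n + 1).smoothNumbers))
      (fun m _ => by rw [hf]; positivity) hhas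
    refine le_trans (le_of_eq ?_) h1
    rw [sum_subtype_of_mem (fun m => f m) hmem]
    rfl
  have hlog : 0 < log x := log_pos hx
  have hpos : ∀ p ∈ {p ∈ Icc 1 n | p.Prime}, (1 : ℝ) < p := fun p hp => by
    exact_mod_cast (mem_filter.1 hp).2.one_lt
  calc log (log x) ≤ log (∏ p ∈ Icc 1 n with p.Prime, (1 - (p : ℝ)⁻¹)⁻¹) :=
        log_le_log hlog hharm
    _ = ∑ p ∈ Icc 1 n with p.Prime, log (1 - (p : ℝ)⁻¹)⁻¹ :=
        log_prod fun p hp => by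
          have := inv_lt_one_of_one_lt₀ (hpos p hp)
          exact (inv_pos.2 (by linarith)).ne'
    _ ≤ ∑ p ∈ Icc 1 n with p.Prime, (1 / (p : ℝ) + (1 / ((p : ℝ) - 1) - 1 / p)) := by
        refine sum_le_sum fun p hp => ?_
        have h1 := hpos p hp
        have h2 := inv_lt_one_of_one_lt₀ h1
        refine (log_le_sub_one_of_pos (inv_pos.2 (by linarith))).trans (le_of_eq ?_)
        have h3 : (p : ℝ) - 1 ≠ 0 := by linarith
        have h4 : (p : ℝ) ≠ 0 := by linarith
        field_simp
        ring
    _ ≤ _ := by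
        rw [sum_add_distrib]
        have h1 := sum_primes_one_div_sub_le hn1
        have h2 : (0 : ℝ) ≤ 1 / n := by positivity
        linarith

lemma sum_primes_one_div_two_pow_le (J : ℕ) :
    ∑ p ∈ Icc (1 : ℕ) (2 ^ (J + 1)) with p.Prime, 1 / (p : ℝ) ≤ 1 / 2 + 4 * harmonic J := by
  induction J with
  | zero =>
    have : {p ∈ Icc 1 (2 ^ (0 + 1)) | p.Prime} = {2} := by
      ext p
      simp only [mem_filter, mem_Icc, mem_singleton]
      constructor
      · rintro ⟨⟨_, h⟩, hp⟩
        exact le_antisymm (by simpa using h) hp.two_le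
      · rintro rfl
        norm_num [Nat.prime_two]
    rw [this]
    norm_num
  | succ J ih =>
    set s := {p ∈ Icc 1 (2 ^ (J + 1 + 1)) | p.Prime} with hs
    set t := {p ∈ Icc 1 (2 ^ (J + 1)) | p.Prime} with ht
    have hpow : 2 ^ (J + 1) ≤ 2 ^ (J + 1 + 1) := Nat.pow_le_pow_right two_pos (Nat.le_succ _)
    have hts : t ⊆ s := filter_subset_filter _ (Icc_subset_Icc_right hpow)
    have hlog2 : 0 < log 2 := log_pos one_lt_two
    have hJ : (0 : ℝ) < J + 1 := by positivity
    have hdiff : ∑ p ∈ s \ t, 1 / (p : ℝ) ≤ 4 / (J + 1) := by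
      have h1 : ∀ p ∈ s \ t, 1 / (p : ℝ) ≤ log p / ((J + 1) * log 2 * 2 ^ (J + 1)) := by
        intro p hp
        obtain ⟨hps, hpt⟩ := mem_sdiff.1 hp
        obtain ⟨hI, hpp⟩ := mem_filter.1 hps
        have hlt : 2 ^ (J + 1) < p := by
          by_contra! h
          exact hpt (mem_filter.2 ⟨mem_Icc.2 ⟨(mem_Icc.1 hI).1, h⟩, hpp⟩)
        have hlt' : (2 : ℝ) ^ (J + 1) ≤ p := by exact_mod_cast hlt.le
        have hl : (J + 1) * log 2 ≤ log p := by
          have := log_le_log (by positivity) hlt'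
          rw [log_pow] at this
          exact_mod_cast this
        have hp0 : (0 : ℝ) < p := by exact_mod_cast hpp.pos
        rw [div_le_div_iff₀ hp0 (by positivity), one_mul]
        gcongr
      have h2 : ∑ p ∈ s, log p ≤ log 4 * 2 ^ (J + 1 + 1) := by
        have := Chebyshev.theta_le_log4_mul_x (x := ((2 ^ (J + 1 + 1) : ℕ) : ℝ)) (by positivity)
        rw [Chebyshev.theta, Nat.floor_natCast] at this
        push_cast at this
        exact this
      have h4 : log 4 = 2 * log 2 := by
        rw [show (4 : ℝ) = 2 ^ 2 by norm_num, log_pow]; norm_num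
      calc _ ≤ ∑ p ∈ s \ t, log p / ((J + 1) * log 2 * 2 ^ (J + 1)) := sum_le_sum h1
        _ ≤ ∑ p ∈ s, log p / ((J + 1) * log 2 * 2 ^ (J + 1)) := by
            refine sum_le_sum_of_subset_of_nonneg sdiff_subset fun p hp _ => ?_
            have : (1 : ℝ) ≤ p := by exact_mod_cast (mem_filter.1 hp).2.one_le
            have := log_nonneg this
            positivity
        _ ≤ log 4 * 2 ^ (J + 1 + 1) / ((J + 1) * log 2 * 2 ^ (J + 1)) := by
            rw [← sum_div]; gcongr
        _ = _ := by
            rw [h4, pow_succ]; field_simp; norm_num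
    rw [← sum_sdiff hts, harmonic_succ]
    push_cast
    have h3 : 4 / ((J : ℝ) + 1) = 4 * ((J : ℝ) + 1)⁻¹ := by ring
    linarith

lemma sum_primes_one_div_le {x : ℝ} (hx : 2 ≤ x) :
    ∑ p ∈ Icc 1 ⌊x⌋₊ with p.Prime, 1 / (p : ℝ) ≤ 4 * log (log x) + 10 := by
  set J := ⌈log x / log 2⌉₊ with hJ
  have hl2 := log_two_gt_d9
  have hl2' := log_two_lt_d9
  have hlog : log 2 ≤ log x := log_le_log two_pos hx
  have h1 : 1 ≤ log x / log 2 := by rw [one_le_div (by linarith)]; exact hlog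
  have hxJ : log x / log 2 ≤ J := Nat.le_ceil _
  have hJlt : (J : ℝ) < log x / log 2 + 1 := Nat.ceil_lt_add_one (by linarith)
  have hJ1 : (1 : ℝ) ≤ J := h1.trans hxJ
  have hx2 : x ≤ ((2 ^ (J + 1) : ℕ) : ℝ) := by
    push_cast
    rw [← log_le_log_iff (by linarith) (by positivity), log_pow]
    rw [div_le_iff₀ (by linarith)] at hxJ
    push_cast
    nlinarith
  have hfl : ⌊x⌋₊ ≤ 2 ^ (J + 1) := Nat.floor_le_of_le hx2
  have hJ3 : (J : ℝ) ≤ 3 * log x := by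
    have : log x / log 2 ≤ 3 / 2 * log x := by
      rw [div_le_iff₀ (by linarith)]; nlinarith
    linarith
  have h2 : log J ≤ log 3 + log (log x) := by
    rw [← log_mul (by norm_num) (by linarith)]
    exact log_le_log (by linarith) hJ3
  have h3 : log 3 ≤ 5 / 4 := by
    have : log 3 = log 2 + log (3 / 2) := by
      rw [← log_mul (by norm_num) (by norm_num)]; norm_num
    have h4 := log_le_sub_one_of_pos (show (0 : ℝ) < 3 / 2 by norm_num)
    linarith
  have h4 := harmonic_le_one_add_log J
  have h5 := sum_primes_one_div_two_pow_le J
  have h6 : ∑ p ∈ Icc 1 ⌊x⌋₊ with p.Prime, 1 / (p : ℝ) ≤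
      ∑ p ∈ Icc (1 : ℕ) (2 ^ (J + 1)) with p.Prime, 1 / (p : ℝ) :=
    sum_le_sum_of_subset_of_nonneg (filter_subset_filter _ (Icc_subset_Icc_right hfl))
      fun p _ _ => by positivity
  linarith

lemma card_primes_with_divisor_le {N q Z : ℕ} (hq : 0 < q) (a : ℤ) {P : Finset ℕ}
    (hP : ∀ p ∈ P, p.Prime) (hPZ : ∀ p ∈ P, p ≤ Z) (hqP : ∀ p ∈ P, q.Coprime p)
    (hPs : ∀ s ∈ Icc 1 N, ∑ p ∈ P with p ∣ s, 1 / (p : ℝ) ≤ 1) {r : ℕ} (hr : Even r)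
    (hr1 : 1 ≤ r) {W : ℝ} (hW : W = ∑ p ∈ P, 1 / (p : ℝ)) (hrW : exp 2 * (2 * W) ≤ r + 1)
    {w β : ℝ} (hw0 : 0 < w) (hw1 : w ≤ 1) (hβ : 1 ≤ β) (v : ℝ) {D T M : ℝ} (hD : 0 < D)
    (hT : 0 ≤ T) {J : ℕ} (hTJ : T ≤ D * 2 ^ J) (hM : M = (r + 1) * (2 * Z + 1) ^ r) :
    (#{p ∈ Icc 1 N | p.Prime ∧ ((p : ℕ) : ZMod q) = (a : ZMod q) ∧
        ∃ d : ℕ, D < (d : ℝ) ∧ (d : ℝ) < T ∧ Nat.gcd d q = 1 ∧ d ∣ p - 1} : ℝ)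
      ≤ N / q * exp (-r) + 9 * (N / q) * (β ^ (-v) * exp (-((2 - β) * W))) + 3 * M ^ 2
        + w ^ (-v) * (9 * (N / q) * exp (-((2 - w) * W)) *
          (J * (18 * exp (-((1 - w) * W)) + M / D)) + T * M) := by
  have hcardP : #P ≤ Z := by
    refine (card_le_card (t := Icc 1 Z) fun p hp => ?_).trans (by simp)
    exact mem_Icc.2 ⟨(hP p hp).one_le, hPZ p hp⟩
  have hcardP' : (#P : ℝ) ≤ Z := by exact_mod_cast hcardP
  have hW0 : 0 ≤ W := hW ▸ sum_nonneg fun p _ => by positivity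
  have hr1' : (1 : ℝ) ≤ r := by exact_mod_cast hr1
  have hpow1 : (1 : ℝ) ≤ (2 * Z + 1) ^ r := one_le_pow₀ (by linarith [Nat.cast_nonneg (α := ℝ) Z])
  have hpowM : ((2 : ℝ) * Z + 1) ^ r ≤ M := by
    rw [hM]
    exact le_mul_of_one_le_left (by positivity) (by linarith)
  have hM1 : 1 ≤ M := hpow1.trans hpowM
  have hZM : (Z : ℝ) ≤ M ^ 2 := by
    have h1 : (2 * (Z : ℝ) + 1) ≤ (2 * Z + 1) ^ r :=
      le_self_pow₀ (by linarith [Nat.cast_nonneg (α := ℝ) Z]) (by omega)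
    nlinarith [Nat.cast_nonneg (α := ℝ) Z]
  set E : ℝ := (r + 1) * (2 * #P + 1) ^ r with hE
  have hE0 : 0 ≤ E := by positivity
  have hEM : E ≤ M := by rw [hE, hM]; gcongr
  set S : Finset ℕ := {d ∈ Icc 1 N | D < (d : ℝ) ∧ (d : ℝ) < T ∧ d.Coprime q} with hS
  have hcardS : (#S : ℝ) ≤ T := by
    have : #S ≤ #(Icc 1 ⌊T⌋₊) := card_le_card fun d hd => by
      obtain ⟨hI, -, h2, -⟩ := mem_filter.1 hd
      exact mem_Icc.2 ⟨(mem_Icc.1 hI).1, Nat.le_floor h2.le⟩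
    rw [Nat.card_Icc, Nat.add_sub_cancel] at this
    exact (Nat.cast_le.2 this).trans (Nat.floor_le hT)
  have hsub : {p ∈ Icc 1 N | p.Prime ∧ ((p : ℕ) : ZMod q) = (a : ZMod q) ∧
        ∃ d : ℕ, D < (d : ℝ) ∧ (d : ℝ) < T ∧ Nat.gcd d q = 1 ∧ d ∣ p - 1} ⊆
      ((Icc 1 Z ∪ {n ∈ Icc 1 N | ((n : ℕ) : ZMod q) = a ∧ r ≤ divCount P (n - 1)}) ∪
        {n ∈ Icc 2 N | ((n : ℕ) : ZMod q) = a ∧ (∀ p ∈ P, ¬ p ∣ n) ∧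
          v ≤ divCount P (n - 1) ∧ divCount P (n - 1) < r}) ∪
        {n ∈ Icc 2 N | ((n : ℕ) : ZMod q) = a ∧ (∀ p ∈ P, ¬ p ∣ n) ∧
          divCount P (n - 1) ≤ v ∧ ∃ d ∈ S, d ∣ n - 1} := by
    intro n hn
    obtain ⟨hI, hnp, hna, d, hd1, hd2, hd3, hd4⟩ := mem_filter.1 hn
    have hn2 : n ∈ Icc 2 N := mem_Icc.2 ⟨hnp.two_le, (mem_Icc.1 hI).2⟩
    rcases le_or_gt n Z with hnZ | hnZ
    · exact mem_union_left _ (mem_union_left _ (mem_union_left _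
        (mem_Icc.2 ⟨hnp.one_le, hnZ⟩)))
    have hnP : ∀ p ∈ P, ¬ p ∣ n := fun p hp hdvd => by
      have := hPZ p hp
      rw [(Nat.prime_dvd_prime_iff_eq (hP p hp) hnp).1 hdvd] at this
      omega
    rcases le_or_gt r (divCount P (n - 1)) with hk | hk
    · exact mem_union_left _ (mem_union_left _ (mem_union_right _
        (mem_filter.2 ⟨hI, hna, hk⟩)))
    rcases le_total v (divCount P (n - 1)) with hv | hv
    · exact mem_union_left _ (mem_union_right _ (mem_filter.2 ⟨hn2, hna, hnP, hv, hk⟩))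
    · refine mem_union_right _ (mem_filter.2 ⟨hn2, hna, hnP, hv, d, mem_filter.2
        ⟨mem_Icc.2 ⟨?_, ?_⟩, hd1, hd2, hd3⟩, hd4⟩)
      · exact_mod_cast hD.trans hd1
      · have := Nat.le_of_dvd (by have := hnp.two_le; omega) hd4
        have := (mem_Icc.1 hI).2
        omega
  have b1 := card_filter_divCount_ge_le N hq a hP hqP r
  have b2 := card_filter_divCount_between_le hq a hP hqP hPs hr (hW ▸ hrW) hβ v r
  have b3 := card_filter_divCount_le_le hq a hP hqP hPs hr (hW ▸ hrW) hw0 hw1 v (S := S)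
    fun d hd => ⟨(mem_filter.1 hd).1, (mem_filter.1 hd).2.2.2⟩
  have b4 : ∑ d ∈ S, w ^ divCount P d / (d : ℝ) ≤
      J * (2 * (9 * exp (-((1 - w) * W))) + E / D) := by
    refine sum_pow_divCount_div_le hw0.le hD (by positivity) hE0 (fun n => ?_) S J
      fun d hd => ⟨(mem_filter.1 hd).2.1, (mem_filter.1 hd).2.2.1.trans_le hTJ⟩
    have := sum_pow_divCount_le hw0.le hw1 n hP hr (hW ▸ hrW)
    rw [← hW] at this
    linarith
  rw [← hW] at b1 b2 b3
  rw [← hE] at b2 b3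
  have hfac : W ^ r / r.factorial ≤ exp (-r) := by
    refine pow_div_factorial_le_exp_neg hW0 ?_
    linarith
  have hPr : (#P : ℝ) ^ r ≤ M ^ 2 := by
    have : (#P : ℝ) ^ r ≤ (2 * Z + 1) ^ r := by gcongr; linarith
    nlinarith
  have hrE : r * (#P + 1 : ℝ) ^ r * E ≤ M ^ 2 := by
    have : r * (#P + 1 : ℝ) ^ r ≤ M := by
      rw [hM]; gcongr <;> linarith
    nlinarith [show 0 ≤ r * (#P + 1 : ℝ) ^ r by positivity]
  have hcard := (card_le_card hsub).trans ((card_union_le _ _).trans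
    (Nat.add_le_add_right ((card_union_le _ _).trans
      (Nat.add_le_add_right (card_union_le _ _) _)) _))
  rw [Nat.card_Icc, Nat.add_sub_cancel] at hcard
  have hcard' := (Nat.cast_le (α := ℝ)).2 hcard
  push_cast at hcard'
  have c1 : (N : ℝ) / q * (W ^ r / r.factorial) ≤ N / q * exp (-r) := by gcongr
  have c3 : w ^ (-v) * (9 * (N / q) * exp (-((2 - w) * W)) *
      ∑ d ∈ S, w ^ divCount P d / (d : ℝ) + #S * E) ≤
      w ^ (-v) * (9 * (N / q) * exp (-((2 - w) * W)) *
          (J * (18 * exp (-((1 - w) * W)) + M / D)) + T * M) := by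
    have : (J : ℝ) * (2 * (9 * exp (-((1 - w) * W))) + E / D) ≤
        J * (18 * exp (-((1 - w) * W)) + M / D) := by
      have h1 : E / D ≤ M / D := by gcongr
      exact mul_le_mul_of_nonneg_left (by linarith) (Nat.cast_nonneg _)
    have := b4.trans this
    gcongr
  linarith

lemma log_seven_div_five_ge : 0.33 ≤ log (7 / 5) := by
  rw [le_log_iff_exp_le (by norm_num)]
  refine (exp_bound' (n := 4) (by norm_num) (by norm_num) (by norm_num)).trans ?_
  norm_num [sum_range_succ, Nat.factorial]

lemma log_seven_div_ten_ge : -0.357 ≤ log (7 / 10) := by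
  have h : log (10 / 7) ≤ 0.357 := by
    rw [log_le_iff_le_exp (by norm_num)]
    refine le_trans ?_ (sum_le_exp_of_nonneg (by norm_num) 5)
    norm_num [sum_range_succ, Nat.factorial]
  rw [show (7 / 10 : ℝ) = (10 / 7)⁻¹ by norm_num, log_inv]
  linarith

lemma sum_one_div_dvd_le_one {P : Finset ℕ} {y X : ℝ} (hP : ∀ p ∈ P, p.Prime)
    (hPy : ∀ p ∈ P, y < p) {s : ℕ} (hs : 1 ≤ s) (hsX : (s : ℝ) ≤ X) (hy : 2 * log X ≤ y) :
    ∑ p ∈ P with p ∣ s, 1 / (p : ℝ) ≤ 1 := by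
  set S := {p ∈ P | p ∣ s} with hS
  have hs1 : (1 : ℝ) ≤ s := by exact_mod_cast hs
  have hX : 0 ≤ log X := log_nonneg (hs1.trans hsX)
  have hcard : (#S : ℝ) ≤ y := by
    have h1 : 2 ^ #S ≤ s := by
      refine le_trans ?_ (Nat.le_of_dvd hs (Finset.prod_primes_dvd (s := S) s
        (fun p hp => (hP p (mem_filter.1 hp).1).prime) fun p hp => (mem_filter.1 hp).2))
      rw [← prod_const]
      exact prod_le_prod' fun p hp => (hP p (mem_filter.1 hp).1).two_le
    have h2 : (2 : ℝ) ^ #S ≤ X := le_trans (by exact_mod_cast h1) hsX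
    have h3 := log_le_log (by positivity) h2
    rw [log_pow] at h3
    nlinarith [log_two_gt_d9, Nat.cast_nonneg (α := ℝ) #S]
  rcases S.eq_empty_or_nonempty with h | ⟨p, hp⟩
  · simp [h]
  · have hy0 : 0 < y := by
      refine lt_of_lt_of_le ?_ hcard
      exact_mod_cast card_pos.2 ⟨p, hp⟩
    calc _ ≤ ∑ _p ∈ S, 1 / y := by
          refine sum_le_sum fun p hp => ?_
          have := hPy p (mem_filter.1 hp).1
          gcongr
      _ = #S / y := by rw [sum_const, nsmul_eq_mul, mul_one_div]
      _ ≤ 1 := (div_le_one hy0).2 hcard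

/-- The primes `p` with `y < p ≤ z`. -/
noncomputable def primesBetween (y z : ℝ) : Finset ℕ :=
  {p ∈ Icc 1 ⌊z⌋₊ | p.Prime ∧ y < (p : ℝ)}

lemma sum_primesBetween_one_div_bounds {y z : ℝ} (hy : 2 ≤ y) (hz : 2 ≤ z) :
    log (log z) - 4 * log (log y) - 11 ≤
        ∑ p ∈ primesBetween y z, 1 / (p : ℝ) ∧
      ∑ p ∈ primesBetween y z, 1 / (p : ℝ) ≤ 4 * log (log z) + 10 := by
  have h1 := log_log_le_sum_primes_one_div (x := z) (by linarith)
  have h2 := sum_primes_one_div_le hy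
  have h3 : ∑ p ∈ Icc 1 ⌊z⌋₊ with p.Prime, 1 / (p : ℝ) ≤
      ∑ p ∈ primesBetween y z, 1 / (p : ℝ) +
        ∑ p ∈ Icc 1 ⌊y⌋₊ with p.Prime, 1 / (p : ℝ) := by
    rw [← sum_filter_add_sum_filter_not {p ∈ Icc 1 ⌊z⌋₊ | p.Prime} (fun p : ℕ => y < (p : ℝ)),
      filter_filter, primesBetween]
    refine add_le_add le_rfl (sum_le_sum_of_subset_of_nonneg (fun p hp => ?_)
      fun p _ _ => by positivity)
    obtain ⟨hp1, hpy⟩ := mem_filter.1 hp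
    obtain ⟨hI, hpp⟩ := mem_filter.1 hp1
    exact mem_filter.2 ⟨mem_Icc.2 ⟨(mem_Icc.1 hI).1, Nat.le_floor (not_lt.1 hpy)⟩, hpp⟩
  refine ⟨by linarith, (sum_le_sum_of_subset_of_nonneg ?_ fun p _ _ => by positivity).trans
    (sum_primes_one_div_le hz)⟩
  exact fun p hp => mem_filter.2 ⟨(mem_filter.1 hp).1, (mem_filter.1 hp).2.1⟩

lemma exists_forall_mul_le_exp_and_log_le (K C : ℝ) :
    ∃ u₀ : ℝ, 10 ≤ u₀ ∧ ∀ u, u₀ ≤ u → K * u ≤ exp u ∧ 5 * log u + C ≤ 0.001 * u := by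
  have h1 := (isLittleO_log_id_atTop.bound (show (0 : ℝ) < 0.0001 by norm_num))
  obtain ⟨u₁, hu₁⟩ := Filter.eventually_atTop.1 h1
  refine ⟨max (max 10 u₁) (max (2 * K) (2000 * C)),
    (le_max_left _ _).trans (le_max_left _ _), fun u hu => ?_⟩
  simp only [max_le_iff] at hu
  obtain ⟨⟨h10, hu1⟩, hK, hC⟩ := hu
  refine ⟨?_, ?_⟩
  · have := quadratic_le_exp_of_nonneg (show 0 ≤ u by linarith)
    nlinarith
  · have h2 := hu₁ u hu1
    rw [id, norm_eq_abs, norm_eq_abs, abs_of_nonneg (by linarith : 0 ≤ u)] at h2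
    have := le_abs_self (log u)
    linarith

lemma succ_mul_pow_le_exp {u L : ℝ} (hu : 10 ≤ u) (hL : 24600 * u ≤ L) {r Z : ℕ}
    (hr : (r : ℝ) ≤ 82 * u) (hZ : (Z : ℝ) ≤ exp (L / (8200 * u))) :
    ((r : ℝ) + 1) * (2 * Z + 1) ^ r ≤ exp (L / 50) := by
  have h1 : (r : ℝ) + 1 ≤ exp r := add_one_le_exp _
  have h2 : (2 * (Z : ℝ) + 1) ≤ exp (2 + L / (8200 * u)) := by
    have h3 : 1 ≤ exp (L / (8200 * u)) := one_le_exp (div_nonneg (by linarith) (by linarith))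
    have h4 := add_one_le_exp 2
    rw [exp_add]
    nlinarith
  have h5 : (2 * (Z : ℝ) + 1) ^ r ≤ exp (r * (2 + L / (8200 * u))) := by
    rw [exp_nat_mul]
    gcongr
  calc _ ≤ exp r * exp (r * (2 + L / (8200 * u))) := by gcongr
    _ = exp (3 * r + r * (L / (8200 * u))) := by rw [← exp_add]; ring_nf
    _ ≤ _ := by
      rw [exp_le_exp]
      have h6 : r * (L / (8200 * u)) ≤ 82 * u * (L / (8200 * u)) :=
        mul_le_mul_of_nonneg_right hr (div_nonneg (by linarith) (by linarith))
      have h7 : 82 * u * (L / (8200 * u)) = L / 100 := by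
        have : u ≠ 0 := by linarith
        field_simp
        ring
      linarith

lemma sieve_terms_le {u L A R W M D T J ρ n rr : ℝ} (hu : 10 ≤ u) (hA : 0 ≤ A)
    (hL : (2 * A + R + 20) * 10 * u ≤ L) (hW : 0.999 * u ≤ W) (hM0 : 0 ≤ M)
    (hM : M ≤ exp (L / 50)) (hD : D = exp (L / 2 - R * u)) (hT : T = exp (L / 2 + R * u))
    (hRA : R = A + 14) (hJ0 : 0 ≤ J) (hJ : J ≤ 4 * R * u) (hρ : exp (L - A * u) ≤ ρ)
    (hn0 : 0 ≤ n) (hn : n ≤ ρ) (hrr : 80 * u ≤ rr) :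
    n * exp (-rr) + 9 * n * ((7 / 5 : ℝ) ^ (-(1.4 * u)) * exp (-((2 - 7 / 5) * W))) + 3 * M ^ 2
        + (7 / 10 : ℝ) ^ (-(1.4 * u)) * (9 * n * exp (-((2 - 7 / 10) * W)) *
          (J * (18 * exp (-((1 - 7 / 10) * W)) + M / D)) + T * M)
      ≤ (14 + 684 * R) * ρ * (u * exp (-(1.06 * u))) := by
  have hR : 14 ≤ R := by rw [hRA]; linarith
  have hρ0 : 0 ≤ ρ := (exp_pos _).le.trans hρ
  have hu0 : 0 < exp (-(1.06 * u)) := exp_pos _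
  have hAu : 0 ≤ A * u := by positivity
  have t1 : n * exp (-rr) ≤ ρ * exp (-(1.06 * u)) := by
    gcongr; linarith
  have t2 : 9 * n * ((7 / 5 : ℝ) ^ (-(1.4 * u)) * exp (-((2 - 7 / 5) * W))) ≤
      9 * ρ * exp (-(1.06 * u)) := by
    have h : (7 / 5 : ℝ) ^ (-(1.4 * u)) * exp (-((2 - 7 / 5) * W)) ≤ exp (-(1.06 * u)) := by
      rw [rpow_def_of_pos (by norm_num), ← exp_add, exp_le_exp]
      nlinarith [log_seven_div_five_ge]
    gcongr
  have t3 : 3 * M ^ 2 ≤ 3 * (ρ * exp (-(1.06 * u))) := by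
    have h1 : M ^ 2 ≤ exp (L / 50) ^ 2 := by gcongr
    have h2 : exp (L / 50) ^ 2 ≤ exp (L - A * u) * exp (-(1.06 * u)) := by
      rw [← exp_nat_mul, ← exp_add, exp_le_exp]
      push_cast
      nlinarith
    have h3 : exp (L - A * u) * exp (-(1.06 * u)) ≤ ρ * exp (-(1.06 * u)) := by gcongr
    linarith
  have hw : (7 / 10 : ℝ) ^ (-(1.4 * u)) ≤ exp (0.5 * u) := by
    rw [rpow_def_of_pos (by norm_num), exp_le_exp]
    nlinarith [log_seven_div_ten_ge]
  have hD0 : 0 < D := hD ▸ exp_pos _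
  have hT0 : 0 < T := hT ▸ exp_pos _
  have hMD : M / D ≤ exp (-(2 * u)) := by
    rw [div_le_iff₀ hD0, hD, ← exp_add]
    refine hM.trans ?_
    rw [exp_le_exp]
    nlinarith
  have hTM : exp (0.5 * u) * (T * M) ≤ ρ * exp (-(1.06 * u)) := by
    calc exp (0.5 * u) * (T * M) ≤ exp (0.5 * u) * (T * exp (L / 50)) := by gcongr
      _ ≤ exp (L - A * u) * exp (-(1.06 * u)) := by
          rw [hT, ← exp_add, ← exp_add, ← exp_add, exp_le_exp]
          nlinarith
      _ ≤ _ := by gcongr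
  have t4 : exp (0.5 * u) * (9 * n * exp (-((2 - 7 / 10) * W)) *
      (J * (18 * exp (-((1 - 7 / 10) * W)) + M / D))) ≤
      684 * R * u * ρ * exp (-(1.06 * u)) := by
    have e1 : exp (0.5 * u) * exp (-((2 - 7 / 10) * W)) * exp (-((1 - 7 / 10) * W)) ≤
        exp (-(1.06 * u)) := by
      rw [← exp_add, ← exp_add, exp_le_exp]; linarith
    have e2 : exp (0.5 * u) * exp (-((2 - 7 / 10) * W)) * (M / D) ≤ exp (-(1.06 * u)) := by
      refine (mul_le_mul_of_nonneg_left hMD (by positivity)).trans ?_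
      rw [← exp_add, ← exp_add, exp_le_exp]; linarith
    calc _ = 9 * n * J * (18 * (exp (0.5 * u) * exp (-((2 - 7 / 10) * W)) *
          exp (-((1 - 7 / 10) * W))) + exp (0.5 * u) * exp (-((2 - 7 / 10) * W)) * (M / D)) := by
          ring
      _ ≤ 9 * n * J * (18 * exp (-(1.06 * u)) + exp (-(1.06 * u))) := by gcongr
      _ ≤ 9 * ρ * (4 * R * u) * (18 * exp (-(1.06 * u)) + exp (-(1.06 * u))) := by gcongr
      _ = _ := by ring
  have t5 : (7 / 10 : ℝ) ^ (-(1.4 * u)) * (9 * n * exp (-((2 - 7 / 10) * W)) *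
      (J * (18 * exp (-((1 - 7 / 10) * W)) + M / D)) + T * M) ≤
      684 * R * u * ρ * exp (-(1.06 * u)) + ρ * exp (-(1.06 * u)) := by
    refine (mul_le_mul_of_nonneg_right hw (by positivity)).trans ?_
    rw [mul_add]
    exact add_le_add t4 hTM
  have t6 : ρ * exp (-(1.06 * u)) ≤ ρ * exp (-(1.06 * u)) * u :=
    le_mul_of_one_le_right (by positivity) (by linarith)
  linarith

lemma card_primes_with_middle_divisor_le_of_large {A : ℝ} (hA : 0 < A) :
    ∃ u₀ : ℝ, ∀ X : ℝ, 1 < X → 1 < log X → u₀ ≤ log (log X) → ∀ (a : ℤ) (q : ℕ), 0 < q →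
      (q : ℝ) ≤ log X ^ A →
      (#{p ∈ Icc 1 ⌊X⌋₊ | p.Prime ∧ ((p : ℕ) : ZMod q) = (a : ZMod q) ∧
        ∃ d : ℕ, X ^ ((1 : ℝ) / 2) / log X ^ (A + 14) < (d : ℝ) ∧
          (d : ℝ) < X / (X ^ ((1 : ℝ) / 2) / log X ^ (A + 14)) ∧
          Nat.gcd d q = 1 ∧ d ∣ p - 1} : ℝ)
      ≤ (14 + 684 * (A + 14)) * (X / q) *
        (log (log X) * exp (-(1.06 * log (log X)))) := by
  obtain ⟨u₀, hu10, hu₀⟩ := exists_forall_mul_le_exp_and_log_le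
    (max 24600 ((2 * A + (A + 14) + 20) * 10)) (log 8200 + 4 * log (A + 2) + 11)
  refine ⟨u₀, fun X hX1 hL1 huX a q hq hqA => ?_⟩
  set L := log X with hLdef
  set u := log L with hudef
  have hL0 : 0 < L := by linarith
  have hX0 : 0 < X := by linarith
  have hXL : exp L = X := exp_log hX0
  have hLu : exp u = L := exp_log hL0
  have hu : 10 ≤ u := hu10.trans huX
  obtain ⟨hK, hlogu⟩ := hu₀ u huX
  rw [hLu] at hK
  have hK1 : 24600 * u ≤ L := le_trans (by gcongr; exact le_max_left _ _) hK
  have hK2 : (2 * A + (A + 14) + 20) * 10 * u ≤ L :=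
    le_trans (by gcongr; exact le_max_right _ _) hK
  have hLpow : ∀ c : ℝ, L ^ c = exp (c * u) := fun c => by
    rw [rpow_def_of_pos hL0, mul_comm]
  set y := exp ((A + 2) * u) with hy
  set z := exp (L / (8200 * u)) with hz
  have hAu : 0 < A * u := by positivity
  have hy2 : 2 ≤ y := by
    have := add_one_le_exp ((A + 2) * u)
    nlinarith
  have hyL : 2 * L ≤ y := by
    have h1 : 2 ≤ exp u := by linarith [add_one_le_exp u]
    calc 2 * L ≤ exp u * exp u := by rw [← hLu]; gcongr
      _ = exp (2 * u) := by rw [← exp_add]; ring_nf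
      _ ≤ y := exp_le_exp.2 (by linarith)
  have hqy : (q : ℝ) ≤ y := by
    refine hqA.trans ?_
    rw [hLpow]
    exact exp_le_exp.2 (by linarith)
  have hz2 : 2 ≤ z := by
    have h1 : 3 ≤ L / (8200 * u) := by
      rw [le_div_iff₀ (by linarith)]; linarith
    linarith [add_one_le_exp (L / (8200 * u))]
  obtain ⟨hW1, hW2⟩ := sum_primesBetween_one_div_bounds hy2 hz2
  have hllz : log (log z) = u - log 8200 - log u := by
    rw [hz, log_exp, log_div hL0.ne' (by linarith), log_mul (by norm_num) (by linarith)]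
    ring
  have hlly : log (log y) = log (A + 2) + log u := by
    rw [hy, log_exp, log_mul (by linarith) (by linarith)]
  set P := primesBetween y z with hP
  set W := ∑ p ∈ P, 1 / (p : ℝ) with hW
  rw [hllz, hlly] at hW1
  rw [hllz] at hW2
  have hlogu0 : 0 ≤ log u := log_nonneg (by linarith)
  have hlog8200 : 0 ≤ log 8200 := log_nonneg (by norm_num)
  have hWlow : 0.999 * u ≤ W := by linarith
  have hWup : W ≤ 5 * u := by linarith
  have hPp : ∀ p ∈ P, p.Prime := fun p hp => (mem_filter.1 hp).2.1
  have hPy : ∀ p ∈ P, y < p := fun p hp => (mem_filter.1 hp).2.2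
  have hPz : ∀ p ∈ P, p ≤ ⌊z⌋₊ := fun p hp => (mem_Icc.1 (mem_filter.1 hp).1).2
  have hqP : ∀ p ∈ P, q.Coprime p := fun p hp => by
    refine ((hPp p hp).coprime_iff_not_dvd.2 fun hd => ?_).symm
    have h1 : (p : ℝ) ≤ q := by exact_mod_cast Nat.le_of_dvd hq hd
    linarith [hPy p hp]
  have hPs : ∀ s ∈ Icc 1 ⌊X⌋₊, ∑ p ∈ P with p ∣ s, 1 / (p : ℝ) ≤ 1 := fun s hs =>
    sum_one_div_dvd_le_one hPp hPy (mem_Icc.1 hs).1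
      ((Nat.cast_le.2 (mem_Icc.1 hs).2).trans (Nat.floor_le hX0.le)) hyL
  obtain ⟨r, hre, hr1, hr2⟩ : ∃ r : ℕ, Even r ∧ 80 * u ≤ r ∧ (r : ℝ) ≤ 82 * u := by
    have h1 : 40 * u ≤ ⌈40 * u⌉₊ := Nat.le_ceil _
    have h2 : (⌈40 * u⌉₊ : ℝ) < 40 * u + 1 := Nat.ceil_lt_add_one (by linarith)
    refine ⟨2 * ⌈40 * u⌉₊, even_two_mul _, ?_, ?_⟩ <;> push_cast <;> linarith
  have hrpos : 1 ≤ r := by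
    have : (0 : ℝ) < r := by linarith
    exact_mod_cast this
  have hrW : exp 2 * (2 * W) ≤ r + 1 := by
    have := exp_two_le
    have h0 : 0 ≤ W := by linarith
    nlinarith
  have hl2 := log_two_gt_d9
  obtain ⟨J, hJ1, hJ2⟩ : ∃ J : ℕ, 2 * (A + 14) * u ≤ J * log 2 ∧ (J : ℝ) ≤ 4 * (A + 14) * u := by
    refine ⟨⌈2 * (A + 14) * u / log 2⌉₊, ?_, ?_⟩
    · rw [← div_le_iff₀ (by linarith)]
      exact Nat.le_ceil _
    · have h1 : (⌈2 * (A + 14) * u / log 2⌉₊ : ℝ) < 2 * (A + 14) * u / log 2 + 1 :=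
        Nat.ceil_lt_add_one (by positivity)
      have h2 : 2 * (A + 14) * u / log 2 ≤ 3 * (A + 14) * u := by
        rw [div_le_iff₀ (by linarith)]
        nlinarith
      nlinarith
  obtain ⟨D, hDdef⟩ : ∃ D, D = exp (L / 2 - (A + 14) * u) := ⟨_, rfl⟩
  obtain ⟨T, hTdef⟩ : ∃ T, T = exp (L / 2 + (A + 14) * u) := ⟨_, rfl⟩
  have hD : X ^ ((1 : ℝ) / 2) / L ^ (A + 14) = D := by
    rw [hDdef, hLpow, exp_sub, rpow_def_of_pos hX0, ← hLdef]
    ring_nf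
  have hT : X / D = T := by
    rw [hDdef, hTdef, ← hXL, ← exp_sub]
    ring_nf
  have hTJ : T ≤ D * 2 ^ J := by
    rw [hDdef, hTdef, ← exp_log (show (0 : ℝ) < 2 ^ J by positivity), log_pow, ← exp_add,
      exp_le_exp]
    linarith
  obtain ⟨M, hM⟩ : ∃ M : ℝ, M = (r + 1) * (2 * ⌊z⌋₊ + 1) ^ r := ⟨_, rfl⟩
  have hM0 : 0 ≤ M := hM ▸ by positivity
  have hML : M ≤ exp (L / 50) :=
    hM ▸ succ_mul_pow_le_exp hu hK1 hr2 (Nat.floor_le (exp_pos _).le)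
  rw [hD, hT]
  have hmain := card_primes_with_divisor_le (N := ⌊X⌋₊) hq a hPp hPz hqP hPs hre hrpos
    hW hrW (w := 7 / 10) (β := 7 / 5) (by norm_num) (by norm_num) (by norm_num) (1.4 * u)
    (hDdef ▸ exp_pos _ : 0 < D) (hTdef ▸ (exp_pos _).le : 0 ≤ T) hTJ hM
  refine hmain.trans (sieve_terms_le hu hA.le hK2 hWlow hM0 hML hDdef hTdef rfl
    (Nat.cast_nonneg J) hJ2 ?_ (by positivity) ?_ hr1)
  · rw [exp_sub, hXL, ← hLpow]
    gcongr
  · gcongr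
    exact Nat.floor_le hX0.le

theorem count_primes_with_middle_divisor (a : ℤ) (ha : a ≠ 0) (A : ℝ) (hA : 0 < A) :
    ∃ C : ℝ, ∀ X : ℝ, Real.exp (Real.exp 1) < X →
      ∀ q : ℕ, 0 < q → (q : ℝ) ≤ Real.log X ^ A → Int.gcd (q : ℤ) a = 1 →
      (((Finset.Icc 1 ⌊X⌋₊).filter
          (fun p : ℕ => p.Prime ∧ (p : ZMod q) = (a : ZMod q) ∧
            ∃ d : ℕ, X ^ ((1 : ℝ) / 2) / Real.log X ^ (A + 14) < (d : ℝ) ∧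
              (d : ℝ) < X / (X ^ ((1 : ℝ) / 2) / Real.log X ^ (A + 14)) ∧
              Nat.gcd d q = 1 ∧ d ∣ p - 1)).card : ℝ)
      ≤ C * ((Real.exp 1 / 2) ^ bigOmega q / (q : ℝ)) *
          (X * Real.log (Real.log X) ^ 3 /
            Real.log X ^ (2 - Real.exp 1 / 2 * Real.log 2)) := by
  obtain ⟨u₀, hu₀⟩ := card_primes_with_middle_divisor_le_of_large hA
  set K : ℝ := 14 + 684 * (A + 14) with hK
  have he := Real.exp_one_gt_d9
  have he' := Real.exp_one_lt_d9
  have hl := Real.log_two_gt_d9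
  have hl' := Real.log_two_lt_d9
  set τ := 2 - Real.exp 1 / 2 * Real.log 2 with hτ
  have hτ0 : 0 ≤ τ := by nlinarith
  have hτ1 : τ ≤ 1.06 := by nlinarith
  have hK0 : 0 ≤ K := by positivity
  refine ⟨K + Real.exp ((A + τ) * u₀), fun X hX q hq hqA _ => ?_⟩
  have hX0 : 0 < X := (Real.exp_pos _).trans hX
  have hL : Real.exp 1 < Real.log X := (Real.lt_log_iff_exp_lt hX0).2 hX
  have hL0 : 0 < Real.log X := (Real.exp_pos _).trans hL
  have hu : 1 < Real.log (Real.log X) := (Real.lt_log_iff_exp_lt hL0).2 hL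
  have hX1 : 1 < X := by
    by_contra! h
    linarith [Real.log_nonpos hX0.le h]
  have hLpow : ∀ c : ℝ, Real.log X ^ c = Real.exp (c * Real.log (Real.log X)) := fun c => by
    rw [Real.rpow_def_of_pos hL0, mul_comm]
  set u := Real.log (Real.log X) with hudef
  have hq0 : (0 : ℝ) < q := by exact_mod_cast hq
  have hΩ : 1 ≤ (Real.exp 1 / 2) ^ bigOmega q := one_le_pow₀ (by linarith)
  have hu3 : u ≤ u ^ 3 := le_self_pow₀ hu.le (by norm_num)
  have hF : X / q * (u * Real.exp (-(τ * u))) ≤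
      (Real.exp 1 / 2) ^ bigOmega q / q * (X * u ^ 3 / Real.log X ^ τ) := by
    rw [hLpow, Real.exp_neg]
    calc X / q * (u * (Real.exp (τ * u))⁻¹) = 1 / q * (X * u / Real.exp (τ * u)) := by ring
      _ ≤ _ := by gcongr
  rw [mul_assoc]
  rcases le_or_gt u₀ u with h | h
  · have h1 := hu₀ X hX1 (by linarith) h a q hq hqA
    refine h1.trans ?_
    calc K * (X / q) * (u * Real.exp (-(1.06 * u)))
        ≤ K * (X / q) * (u * Real.exp (-(τ * u))) := by
          have : Real.exp (-(1.06 * u)) ≤ Real.exp (-(τ * u)) := by gcongr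
          gcongr
      _ = K * (X / q * (u * Real.exp (-(τ * u)))) := by ring
      _ ≤ (K + Real.exp ((A + τ) * u₀)) * (X / q * (u * Real.exp (-(τ * u)))) := by
          gcongr
          exact le_add_of_nonneg_right (Real.exp_pos _).le
      _ ≤ _ := by gcongr
  · refine (Nat.cast_le.2 (card_filter_le _ _)).trans ?_
    rw [Nat.card_Icc, Nat.add_sub_cancel]
    refine (Nat.floor_le hX0.le).trans ?_
    have h2 : (q : ℝ) * Real.exp (τ * u) ≤ Real.exp ((A + τ) * u₀) := by
      rw [hLpow] at hqA
      calc (q : ℝ) * Real.exp (τ * u) ≤ Real.exp (A * u) * Real.exp (τ * u) := by gcongr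
        _ = Real.exp ((A + τ) * u) := by rw [← Real.exp_add]; ring_nf
        _ ≤ _ := by gcongr
    calc X = q * Real.exp (τ * u) * (X / q * (1 * Real.exp (-(τ * u)))) := by
          rw [Real.exp_neg]; field_simp
      _ ≤ (K + Real.exp ((A + τ) * u₀)) * (X / q * (u * Real.exp (-(τ * u)))) := by
          gcongr
          exact h2.trans (le_add_of_nonneg_left hK0)
      _ ≤ _ := by gcongr
end

section
/- There is an absolute constant C such that for all X ≥ 16 and all positive integers q ≤ X, #{n ≤ X : n ≡ 0 (mod q), Ω(n) > 12 log log X} ≤ C · (e^{1/4})^{Ω(q)} · X / (q (log X)^2). -/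
open Finset Real

open scoped Classical

theorem bigOmega_mul {m n : ℕ} (hm : m ≠ 0) (hn : n ≠ 0) :
    bigOmega (m * n) = bigOmega m + bigOmega n :=
  ArithmeticFunction.cardFactors_mul hm hn

theorem two_pow_bigOmega_le {n : ℕ} (hn : n ≠ 0) : 2 ^ bigOmega n ≤ n := by
  calc 2 ^ bigOmega n ≤ n.primeFactorsList.prod :=
        List.pow_card_le_prod _ _ fun p hp => (Nat.prime_of_mem_primeFactorsList hp).two_le
    _ = n := Nat.prod_primeFactorsList hn

theorem two_pow_bigOmega_le_card_divisors {n : ℕ} (hn : Squarefree n) :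
    2 ^ bigOmega n ≤ #n.divisors := by
  have h : bigOmega n = #n.primeFactors :=
    ((ArithmeticFunction.cardDistinctFactors_eq_cardFactors_iff_squarefree hn.ne_zero).2 hn).symm
  rw [h, Nat.card_divisors hn.ne_zero]
  refine Finset.pow_card_le_prod _ _ _ fun p hp => ?_
  have := (Nat.prime_of_mem_primeFactors hp).factorization_pos_of_dvd hn.ne_zero
    (Nat.dvd_of_mem_primeFactors hp)
  omega

theorem sum_filter_dvd_div (f : ℕ → ℝ) (N : ℕ) {d : ℕ} (hd : 0 < d) :
    ∑ m ∈ (Icc 1 N).filter (d ∣ ·), f (m / d) = ∑ k ∈ Icc 1 (N / d), f k := by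
  refine Finset.sum_nbij' (· / d) (d * ·) ?_ ?_ ?_ ?_ ?_
  · intro m hm
    simp only [mem_filter, mem_Icc] at hm ⊢
    exact ⟨Nat.div_pos (Nat.le_of_dvd hm.1.1 hm.2) hd, Nat.div_le_div_right hm.1.2⟩
  · intro k hk
    simp only [mem_filter, mem_Icc] at hk ⊢
    refine ⟨⟨Nat.mul_pos hd hk.1, ?_⟩, dvd_mul_right _ _⟩
    rw [mul_comm]
    exact (Nat.le_div_iff_mul_le hd).1 hk.2
  · intro m hm
    exact Nat.mul_div_cancel' (mem_filter.1 hm).2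
  · intro k _
    exact Nat.mul_div_cancel_left k hd
  · intro m _
    rfl

theorem sum_card_divisors_le (N : ℕ) :
    ∑ k ∈ Icc 1 N, (#k.divisors : ℝ) ≤ N * (1 + Real.log N) := by
  have h1 : ∀ k ∈ Icc 1 N, (#k.divisors : ℝ) = ∑ u ∈ Icc 1 N, if u ∣ k then (1 : ℝ) else 0 := by
    intro k hk
    rw [mem_Icc] at hk
    rw [← Finset.sum_filter, Finset.sum_const, nsmul_one]
    congr 2
    ext u
    simp only [Nat.mem_divisors, mem_filter, mem_Icc]
    constructor
    · rintro ⟨h, -⟩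
      exact ⟨⟨Nat.pos_of_dvd_of_pos h hk.1, (Nat.le_of_dvd hk.1 h).trans hk.2⟩, h⟩
    · rintro ⟨-, h⟩
      exact ⟨h, by omega⟩
  rw [Finset.sum_congr rfl h1, Finset.sum_comm]
  calc ∑ u ∈ Icc 1 N, ∑ k ∈ Icc 1 N, (if u ∣ k then (1 : ℝ) else 0)
      ≤ ∑ u ∈ Icc 1 N, (N : ℝ) * (u : ℝ)⁻¹ := by
        refine Finset.sum_le_sum fun u hu => ?_
        rw [← Finset.sum_filter, sum_filter_dvd_div (fun _ => 1) N (mem_Icc.1 hu).1]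
        simpa [div_eq_mul_inv] using (Nat.cast_div_le : ((N / u : ℕ) : ℝ) ≤ N / u)
    _ = N * (harmonic N : ℝ) := by
        rw [← Finset.mul_sum, harmonic_eq_sum_Icc]
        push_cast
        rfl
    _ ≤ N * (1 + Real.log N) := by
        gcongr
        exact harmonic_le_one_add_log N

theorem exp_quarter_le_two : Real.exp (1 / 4) ≤ 2 := by
  rw [← Real.le_log_iff_exp_le two_pos]
  linarith [Real.log_two_gt_d9]

theorem exp_quarter_pow_two_mul_bigOmega_le {b : ℕ} (hb : 0 < b) :
    Real.exp (1 / 4) ^ (2 * bigOmega b) ≤ (b : ℝ) ^ (3 / 4 : ℝ) := by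
  have hb' : (0 : ℝ) < b := by exact_mod_cast hb
  have h : (bigOmega b : ℝ) * Real.log 2 ≤ Real.log b := by
    rw [← Real.log_pow]
    exact Real.log_le_log (by positivity) (by exact_mod_cast two_pow_bigOmega_le hb.ne')
  rw [Real.rpow_def_of_pos hb', ← Real.exp_nat_mul, Real.exp_le_exp]
  push_cast
  nlinarith [Real.log_two_gt_d9, (Nat.cast_nonneg (bigOmega b) : (0 : ℝ) ≤ _)]

theorem exp_quarter_pow_bigOmega_le_sum {m N : ℕ} (hm : m ∈ Icc 1 N) :
    Real.exp (1 / 4) ^ bigOmega m ≤ ∑ b ∈ Icc 1 N,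
      if b ^ 2 ∣ m then (b : ℝ) ^ (3 / 4 : ℝ) * #(m / b ^ 2).divisors else 0 := by
  rw [mem_Icc] at hm
  obtain ⟨a, b, hab, ha⟩ := Nat.sq_mul_squarefree m
  have hb : 0 < b := by
    rcases Nat.eq_zero_or_pos b with rfl | h
    · simp at hab
      omega
    · exact h
  have hbm : b ^ 2 ∣ m := ⟨a, hab.symm⟩
  have hbN : b ≤ N :=
    ((Nat.le_self_pow two_ne_zero b).trans (Nat.le_of_dvd hm.1 hbm)).trans hm.2
  have hdiv : m / b ^ 2 = a := by
    rw [← hab]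
    exact Nat.mul_div_cancel_left a (by positivity)
  have hΩ : bigOmega m = 2 * bigOmega b + bigOmega a := by
    rw [← hab, bigOmega_mul (by positivity) ha.ne_zero, sq, bigOmega_mul hb.ne' hb.ne']
    ring
  refine le_trans ?_ (Finset.single_le_sum (f := fun b : ℕ =>
    if b ^ 2 ∣ m then (b : ℝ) ^ (3 / 4 : ℝ) * #(m / b ^ 2).divisors else 0)
    (fun i _ => by positivity) (mem_Icc.2 ⟨hb, hbN⟩))
  simp only [if_pos hbm, hdiv]
  rw [hΩ, pow_add]
  refine mul_le_mul (exp_quarter_pow_two_mul_bigOmega_le hb) ?_ (by positivity) (by positivity)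
  calc Real.exp (1 / 4) ^ bigOmega a ≤ 2 ^ bigOmega a :=
        pow_le_pow_left₀ (by positivity) exp_quarter_le_two _
    _ ≤ #a.divisors := by exact_mod_cast two_pow_bigOmega_le_card_divisors ha

theorem sum_exp_quarter_pow_bigOmega_le (N : ℕ) :
    ∑ m ∈ Icc 1 N, Real.exp (1 / 4) ^ bigOmega m
      ≤ (∑' b : ℕ, ((b : ℝ) ^ (5 / 4 : ℝ))⁻¹) * (N * (1 + Real.log N)) := by
  have hlog := Real.log_natCast_nonneg N
  calc ∑ m ∈ Icc 1 N, Real.exp (1 / 4) ^ bigOmega m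
      ≤ ∑ m ∈ Icc 1 N, ∑ b ∈ Icc 1 N,
          if b ^ 2 ∣ m then (b : ℝ) ^ (3 / 4 : ℝ) * #(m / b ^ 2).divisors else 0 :=
        Finset.sum_le_sum fun m hm => exp_quarter_pow_bigOmega_le_sum hm
    _ = ∑ b ∈ Icc 1 N, (b : ℝ) ^ (3 / 4 : ℝ) * ∑ k ∈ Icc 1 (N / b ^ 2), (#k.divisors : ℝ) := by
        rw [Finset.sum_comm]
        refine Finset.sum_congr rfl fun b hb => ?_
        have hb : 0 < b := (mem_Icc.1 hb).1
        rw [← Finset.sum_filter, ← Finset.mul_sum,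
          sum_filter_dvd_div (fun k => (#k.divisors : ℝ)) N (by positivity : 0 < b ^ 2)]
    _ ≤ ∑ b ∈ Icc 1 N, ((b : ℝ) ^ (5 / 4 : ℝ))⁻¹ * (N * (1 + Real.log N)) := by
        refine Finset.sum_le_sum fun b hb => ?_
        have hb : (0 : ℝ) < b := by exact_mod_cast (mem_Icc.1 hb).1
        have hle : ((N / b ^ 2 : ℕ) : ℝ) ≤ N / (b : ℝ) ^ 2 := by
          exact_mod_cast (Nat.cast_div_le : ((N / b ^ 2 : ℕ) : ℝ) ≤ (N : ℝ) / ((b ^ 2 : ℕ) : ℝ))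
        have hlog' : Real.log (N / b ^ 2 : ℕ) ≤ Real.log N := by
          rcases Nat.eq_zero_or_pos (N / b ^ 2) with h | h
          · simpa [h] using hlog
          · exact Real.log_le_log (by exact_mod_cast h) (by exact_mod_cast Nat.div_le_self _ _)
        have hpow : (b : ℝ) ^ (3 / 4 : ℝ) / (b : ℝ) ^ 2 = ((b : ℝ) ^ (5 / 4 : ℝ))⁻¹ := by
          rw [← Real.rpow_natCast, ← Real.rpow_sub hb, ← Real.rpow_neg hb.le]
          norm_num
        calc (b : ℝ) ^ (3 / 4 : ℝ) * ∑ k ∈ Icc 1 (N / b ^ 2), (#k.divisors : ℝ)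
            ≤ (b : ℝ) ^ (3 / 4 : ℝ) * ((N / b ^ 2 : ℕ) * (1 + Real.log (N / b ^ 2 : ℕ))) := by
              gcongr
              exact sum_card_divisors_le _
          _ ≤ (b : ℝ) ^ (3 / 4 : ℝ) * (N / (b : ℝ) ^ 2 * (1 + Real.log N)) := by
              have := Real.log_natCast_nonneg (N / b ^ 2)
              gcongr
          _ = (b : ℝ) ^ (3 / 4 : ℝ) / (b : ℝ) ^ 2 * (N * (1 + Real.log N)) := by ring
          _ = _ := by rw [hpow]
    _ ≤ _ := by
        rw [← Finset.sum_mul]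
        gcongr
        exact (Real.summable_nat_rpow_inv.2 (by norm_num)).sum_le_tsum _
          fun b _ => by positivity

theorem count_many_prime_factors_in_progression :
    ∃ C : ℝ, ∀ X : ℝ, 16 ≤ X → ∀ q : ℕ, 0 < q → (q : ℝ) ≤ X →
      (((Finset.Icc 1 ⌊X⌋₊).filter
          (fun n : ℕ => q ∣ n ∧
            12 * Real.log (Real.log X) < (bigOmega n : ℝ))).card : ℝ)
      ≤ C * Real.exp (1 / 4) ^ bigOmega q * X / ((q : ℝ) * Real.log X ^ 2) := by
  set K : ℝ := ∑' b : ℕ, ((b : ℝ) ^ (5 / 4 : ℝ))⁻¹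
  have hK0 : 0 ≤ K := tsum_nonneg fun b => by positivity
  refine ⟨2 * K, fun X hX q hq hqX => ?_⟩
  have hq' : (0 : ℝ) < q := by exact_mod_cast hq
  have hL : 1 ≤ Real.log X := by
    rw [Real.le_log_iff_exp_le (by linarith)]
    linarith [Real.exp_one_lt_d9]
  have hL0 : 0 < Real.log X := by linarith
  set N := ⌊X⌋₊ / q
  have hNX : (N : ℝ) ≤ X / q :=
    Nat.cast_div_le.trans (by gcongr; exact Nat.floor_le (by linarith))
  have hlogN : Real.log N ≤ Real.log X := by
    rcases Nat.eq_zero_or_pos N with h | h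
    · simpa [h] using hL0.le
    · refine Real.log_le_log (by exact_mod_cast h) (hNX.trans (div_le_self (by linarith) ?_))
      exact_mod_cast hq
  have hrankin : ∀ n : ℕ, 12 * Real.log (Real.log X) < (bigOmega n : ℝ) →
      1 ≤ Real.exp (1 / 4) ^ bigOmega n / Real.log X ^ 3 := by
    intro n hn
    rw [one_le_div (by positivity), ← Real.exp_log (pow_pos hL0 3), Real.log_pow,
      ← Real.exp_nat_mul, Real.exp_le_exp]
    push_cast
    linarith
  calc (((Finset.Icc 1 ⌊X⌋₊).filter
          (fun n : ℕ => q ∣ n ∧ 12 * Real.log (Real.log X) < (bigOmega n : ℝ))).card : ℝ)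
      = ∑ n ∈ (Finset.Icc 1 ⌊X⌋₊).filter
          (fun n : ℕ => q ∣ n ∧ 12 * Real.log (Real.log X) < (bigOmega n : ℝ)), (1 : ℝ) := by simp
    _ ≤ ∑ n ∈ (Finset.Icc 1 ⌊X⌋₊).filter
          (fun n : ℕ => q ∣ n ∧ 12 * Real.log (Real.log X) < (bigOmega n : ℝ)),
          Real.exp (1 / 4) ^ bigOmega n / Real.log X ^ 3 :=
        Finset.sum_le_sum fun n hn => hrankin n (mem_filter.1 hn).2.2
    _ ≤ ∑ n ∈ (Finset.Icc 1 ⌊X⌋₊).filter (q ∣ ·),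
          Real.exp (1 / 4) ^ bigOmega n / Real.log X ^ 3 := by
        refine Finset.sum_le_sum_of_subset_of_nonneg ?_ fun n _ _ => by positivity
        intro n hn
        rw [mem_filter] at hn ⊢
        exact ⟨hn.1, hn.2.1⟩
    _ = ∑ n ∈ (Finset.Icc 1 ⌊X⌋₊).filter (q ∣ ·),
          Real.exp (1 / 4) ^ bigOmega q / Real.log X ^ 3 *
            Real.exp (1 / 4) ^ bigOmega (n / q) := by
        refine Finset.sum_congr rfl fun n hn => ?_
        rw [mem_filter, mem_Icc] at hn
        have h : bigOmega n = bigOmega q + bigOmega (n / q) := by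
          rw [← bigOmega_mul hq.ne' (Nat.div_pos (Nat.le_of_dvd hn.1.1 hn.2) hq).ne',
            Nat.mul_div_cancel' hn.2]
        rw [h, pow_add]
        ring
    _ = Real.exp (1 / 4) ^ bigOmega q / Real.log X ^ 3 *
          ∑ k ∈ Icc 1 N, Real.exp (1 / 4) ^ bigOmega k := by
        rw [← Finset.mul_sum,
          sum_filter_dvd_div (fun k => Real.exp (1 / 4) ^ bigOmega k) ⌊X⌋₊ hq]
    _ ≤ Real.exp (1 / 4) ^ bigOmega q / Real.log X ^ 3 * (K * (X / q * (2 * Real.log X))) := by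
        gcongr
        refine (sum_exp_quarter_pow_bigOmega_le N).trans ?_
        have := Real.log_natCast_nonneg N
        gcongr
        linarith
    _ = _ := by
        field_simp
end
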